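/- Define f_k = ∑_{n: Ω(n)=k} 1/(n log n), where Ω(n) counts prime factors of n with multiplicity. Then f_k = 1 − (log 2/4)·2^{−k}·(d·k² + O(k log(k+1))) uniformly for k ≥ 1, where d = (1/4)∏_{p>2}(1−2/p)^{−1}(1−1/p)². In particular, f_{k−1} < f_k for all sufficiently large k. -/

import Mathlib

open scoped BigOperators Classical

/-- The Erdős sum `f_k = ∑_{Ω(n)=k} 1/(n log n)`. -/
noncomputable def erdosSum (k : ℕ) : ℝ :=
  ∑' n : ℕ, if 1 < n ∧ n.primeFactorsList.length = k
    then 1 / (n * Real.log n) else 0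

/-- The constant `d = (1/4) ∏_{p>2} (1-2/p)⁻¹ (1-1/p)²`. -/
noncomputable def dConst : ℝ :=
  (1 / 4) * ∏' p : Nat.Primes,
    if 2 < (p : ℕ) then (1 - 2 / ((p : ℕ) : ℝ))⁻¹ * (1 - 1 / ((p : ℕ) : ℝ)) ^ 2 else 1

theorem one_le_mul_tsum_rpow {u : ℝ} (hu : 0 < u) :
    1 ≤ u * ∑' n : ℕ, 1 / ((n : ℝ) + 1) ^ (1 + u) := by
  have hs : Summable fun n : ℕ => 1 / ((n : ℝ) + 1) ^ (1 + u) := by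
    have := (summable_nat_add_iff 1).2 (Real.summable_one_div_nat_rpow.2 (show 1 < 1 + u by linarith))
    simpa using this
  have hterm : ∀ n : ℕ, ((n : ℝ) + 1) ^ (-u) - ((n + 1 : ℕ) + 1 : ℝ) ^ (-u) ≤
      u * (1 / ((n : ℝ) + 1) ^ (1 + u)) := by
    intro n
    have hn : (0 : ℝ) < n + 1 := by positivity
    have hb : 1 - u / (n + 1) ≤ (1 + 1 / ((n : ℝ) + 1)) ^ (-u) := by
      have h1 : 1 + 1 / ((n : ℝ) + 1) ≤ Real.exp (1 / (n + 1)) := by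
        have := Real.add_one_le_exp (1 / ((n : ℝ) + 1)); linarith
      calc 1 - u / (n + 1) ≤ Real.exp (-(u / (n + 1))) := by
            have := Real.add_one_le_exp (-(u / ((n : ℝ) + 1))); linarith
        _ = Real.exp (1 / (n + 1)) ^ (-u) := by rw [← Real.exp_mul]; ring_nf
        _ ≤ _ := Real.rpow_le_rpow_of_nonpos (by positivity) h1 (by linarith)
    have e1 : ((n + 1 : ℕ) + 1 : ℝ) = (n + 1) * (1 + 1 / ((n : ℝ) + 1)) := by
      push_cast; field_simp
    have e2 : 1 / ((n : ℝ) + 1) ^ (1 + u) = ((n : ℝ) + 1) ^ (-u) / (n + 1) := by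
      rw [Real.rpow_add hn, Real.rpow_one, Real.rpow_neg hn.le]; field_simp
    rw [e1, e2, Real.mul_rpow hn.le (by positivity)]
    have : 0 < ((n : ℝ) + 1) ^ (-u) := by positivity
    have h3 := mul_le_mul_of_nonneg_left hb this.le
    have : ((n : ℝ) + 1) ^ (-u) * (1 - u / (n + 1)) =
      ((n : ℝ) + 1) ^ (-u) - u * (((n : ℝ) + 1) ^ (-u) / (n + 1)) := by ring
    linarith
  have hpart : ∀ N : ℕ, 1 - ((N : ℝ) + 1) ^ (-u) ≤ u * ∑' n : ℕ, 1 / ((n : ℝ) + 1) ^ (1 + u) := by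
    intro N
    calc 1 - ((N : ℝ) + 1) ^ (-u)
        = ∑ n ∈ Finset.range N, (((n : ℝ) + 1) ^ (-u) - ((n + 1 : ℕ) + 1 : ℝ) ^ (-u)) := by
          rw [Finset.sum_range_sub' (fun n : ℕ => ((n : ℝ) + 1) ^ (-u))]; simp
      _ ≤ ∑ n ∈ Finset.range N, u * (1 / ((n : ℝ) + 1) ^ (1 + u)) :=
          Finset.sum_le_sum fun n _ => hterm n
      _ ≤ _ := by
          rw [← Finset.mul_sum]
          exact mul_le_mul_of_nonneg_left (hs.sum_le_tsum _ fun n _ => by positivity) hu.le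
  have hlim : Filter.Tendsto (fun N : ℕ => 1 - ((N : ℝ) + 1) ^ (-u)) Filter.atTop (nhds (1 - 0)) :=
    tendsto_const_nhds.sub ((tendsto_rpow_neg_atTop hu).comp
      (Filter.tendsto_atTop_add_const_right _ _ tendsto_natCast_atTop_atTop))
  simpa using le_of_tendsto' hlim hpart

theorem mul_tsum_rpow_le {u : ℝ} (hu : 0 < u) :
    u * ∑' n : ℕ, 1 / ((n : ℝ) + 1) ^ (1 + u) ≤ 1 + u := by
  have h := ZetaAsymptotics.zeta_limit_aux1 (s := 1 + u) (by linarith)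
  have h0 : 0 ≤ ZetaAsymptotics.termTSum (1 + u) :=
    tsum_nonneg fun n => ZetaAsymptotics.term_nonneg _ _
  have h1 : ∑' n : ℕ, 1 / ((n : ℝ) + 1) ^ (1 + u) ≤ 1 + 1 / u := by
    have : 0 ≤ (1 + u) * ZetaAsymptotics.termTSum (1 + u) := by positivity
    simp only [add_sub_cancel_left] at h
    linarith
  calc _ ≤ u * (1 + 1 / u) := mul_le_mul_of_nonneg_left h1 hu.le
    _ = _ := by field_simp; ring

/-- Coefficients of a bounded analytic function satisfy Cauchy's estimates. -/
theorem exists_coeff_of_differentiableOn {f : ℂ → ℂ} {R r M : ℝ} (hr : 0 < r) (hrR : r < R)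
    (hf : DifferentiableOn ℂ f (Metric.ball 0 R))
    (hM : ∀ z, ‖z‖ = r → ‖f z‖ ≤ M) :
    ∃ a : ℕ → ℂ, (∀ l, ‖a l‖ ≤ M * (1 / r) ^ l) ∧
      ∀ z, ‖z‖ < r → HasSum (fun l => a l * z ^ l) (f z) := by
  have hsub : Metric.closedBall (0 : ℂ) r ⊆ Metric.ball 0 R := Metric.closedBall_subset_ball hrR
  have hd : DiffContOnCl ℂ f (Metric.ball 0 r) :=
    (hf.mono (by rwa [closure_ball _ hr.ne'])).diffContOnCl
  refine ⟨fun l => (l.factorial : ℂ)⁻¹ * iteratedDeriv l f 0, fun l => ?_, fun z hz => ?_⟩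
  · have := Complex.norm_iteratedDeriv_le_of_forall_mem_sphere_norm_le l hr hd
      (fun z hz => hM z (by simpa using hz))
    rw [norm_mul, norm_inv, Complex.norm_natCast, one_div, inv_pow, ← div_eq_mul_inv,
      inv_mul_le_iff₀ (by positivity), ← mul_div_assoc]
    exact this
  · have := Complex.hasSum_taylorSeries_on_ball hf
      (show z ∈ Metric.ball 0 R by simpa using hz.trans hrR)
    simpa [smul_eq_mul, mul_assoc, mul_comm, mul_left_comm] using this

/-- Power series that agree near the origin have equal coefficients. -/
theorem coeff_eq_of_hasSum {a b : ℕ → ℂ} {f : ℂ → ℂ}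
    (ha : ∀ z, ‖z‖ < 1 → HasSum (fun n => a n * z ^ n) (f z))
    (hb : ∀ z, ‖z‖ < 1 → HasSum (fun n => b n * z ^ n) (f z)) (n : ℕ) : a n = b n := by
  have key : ∀ c : ℕ → ℂ, (∀ z, ‖z‖ < 1 → HasSum (fun n => c n * z ^ n) (f z)) →
      HasFPowerSeriesAt f (FormalMultilinearSeries.ofScalars ℂ c) 0 := by
    intro c hc
    rw [hasFPowerSeriesAt_iff]
    filter_upwards [Metric.ball_mem_nhds (0 : ℂ) one_pos] with z hz
    simpa [FormalMultilinearSeries.coeff_ofScalars, mul_comm] using hc z (by simpa using hz)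
  have := (key a ha).eq_formalMultilinearSeries (key b hb)
  simpa [FormalMultilinearSeries.coeff_ofScalars] using congrArg (fun p => p.coeff n) this

/-- The logarithm of the Euler factor `(1 - z w)⁻¹ (1 - w)^z`. -/
noncomputable def logFactor (z : ℂ) (w : ℝ) : ℂ :=
  -Complex.log (1 - z * w) + z * (Real.log (1 - w) : ℝ)

theorem norm_mul_le_of_norm_le {z : ℂ} {w : ℝ} (hz : ‖z‖ ≤ 11 / 4) (hw : 0 ≤ w) (hw' : w ≤ 1 / 3) :
    ‖z * w‖ ≤ 11 / 12 := by
  rw [norm_mul, Complex.norm_real, Real.norm_of_nonneg hw]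
  nlinarith [norm_nonneg z]

theorem one_sub_mem_slitPlane {v : ℂ} (hv : ‖v‖ ≤ 11 / 12) : 1 - v ∈ Complex.slitPlane := by
  left
  have := Complex.re_le_norm v
  simp only [Complex.sub_re, Complex.one_re]
  linarith

theorem norm_logFactor_sub_le {z : ℂ} {w w' : ℝ} (hz : ‖z‖ ≤ 11 / 4) (h0 : 0 ≤ w') (h1 : w' ≤ w)
    (h2 : w ≤ 1 / 3) : ‖logFactor z w - logFactor z w'‖ ≤ 200 * w * (w - w') := by
  have hder : ∀ x ∈ Set.Icc w' w, HasDerivWithinAt (logFactor z)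
      (z / (1 - z * x) + z * ((-1 / (1 - x) : ℝ) : ℂ)) (Set.Icc w' w) x := by
    intro x hx
    have hm := one_sub_mem_slitPlane
      (norm_mul_le_of_norm_le hz (h0.trans hx.1) (hx.2.trans h2))
    have d1 : HasDerivAt (fun x : ℝ => 1 - z * (x : ℂ)) (-(z * 1)) x := by
      exact ((Complex.ofRealCLM.hasDerivAt (x := x)).const_mul z).const_sub 1
    have d2 := (d1.clog_real hm).neg
    have d3 : HasDerivAt (fun x : ℝ => Real.log (1 - x)) (-1 / (1 - x)) x :=
      ((hasDerivAt_id x).const_sub 1).log (by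
        have := hx.2.trans h2
        simp only [id]; linarith)
    have := d2.add (d3.ofReal_comp.const_mul z)
    refine (this.congr_deriv ?_).hasDerivWithinAt
    rw [mul_one, neg_div, neg_neg]
  have hb : ∀ x ∈ Set.Icc w' w, ‖z / (1 - z * x) + z * ((-1 / (1 - x) : ℝ) : ℂ)‖ ≤ 200 * w := by
    intro x hx
    have hx0 : 0 ≤ x := h0.trans hx.1
    have hx3 : x ≤ 1 / 3 := hx.2.trans h2
    have hv := norm_mul_le_of_norm_le hz hx0 hx3
    have hn1 : 1 / 12 ≤ ‖1 - z * x‖ := by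
      have := norm_sub_norm_le (1 : ℂ) (z * x)
      rw [norm_one] at this; linarith
    have hn2 : 2 / 3 ≤ ‖(1 : ℂ) - x‖ := by
      rw [← Complex.ofReal_one, ← Complex.ofReal_sub, Complex.norm_real, Real.norm_of_nonneg] <;>
        linarith
    have e : z / (1 - z * x) + z * ((-1 / (1 - x) : ℝ) : ℂ) =
        z * (z - 1) * x / ((1 - z * x) * (1 - x)) := by
      have a1 : 1 - z * x ≠ 0 := by rw [← norm_pos_iff]; linarith
      have a2 : (1 : ℂ) - x ≠ 0 := by rw [← norm_pos_iff]; linarith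
      push_cast
      field_simp
      ring
    have hz1 : ‖z - 1‖ ≤ 15 / 4 := by
      have := norm_sub_le z 1
      rw [norm_one] at this; linarith
    rw [e, norm_div, norm_mul, norm_mul, norm_mul, Complex.norm_real, Real.norm_of_nonneg hx0,
      div_le_iff₀ (by positivity)]
    have A : ‖z‖ * ‖z - 1‖ * x ≤ 11 / 4 * (15 / 4) * w := by
      have := hx.2; gcongr
    have B : 1 / 12 * (2 / 3) ≤ ‖1 - z * x‖ * ‖(1 : ℂ) - x‖ := by gcongr
    have hw : 0 ≤ w := hx0.trans hx.2
    nlinarith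
  have := Convex.norm_image_sub_le_of_norm_hasDerivWithin_le hder hb (convex_Icc _ _)
    (Set.left_mem_Icc.2 h1) (Set.right_mem_Icc.2 h1)
  rwa [Real.norm_of_nonneg (sub_nonneg.2 h1)] at this

theorem norm_logFactor_le {z : ℂ} {w : ℝ} (hz : ‖z‖ ≤ 11 / 4) (h0 : 0 ≤ w) (h2 : w ≤ 1 / 3) :
    ‖logFactor z w‖ ≤ 200 * w ^ 2 := by
  have := norm_logFactor_sub_le hz le_rfl h0 h2
  simp only [logFactor, Complex.ofReal_zero, mul_zero, sub_zero, Complex.log_one, neg_zero,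
    Real.log_one, add_zero] at this ⊢
  linarith

theorem differentiableAt_logFactor {z : ℂ} {w : ℝ} (hz : ‖z‖ ≤ 11 / 4) (h0 : 0 ≤ w)
    (h2 : w ≤ 1 / 3) : DifferentiableAt ℂ (fun z => logFactor z w) z := by
  unfold logFactor
  have := one_sub_mem_slitPlane (norm_mul_le_of_norm_le hz h0 h2)
  fun_prop (disch := assumption)

theorem prime_rpow_le_third {p : Nat.Primes} (hp : (p : ℕ) ≠ 2) {u : ℝ} (hu : 0 ≤ u) :
    ((p : ℕ) : ℝ) ^ (-(1 + u)) ≤ 1 / 3 := by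
  have h3 : (3 : ℝ) ≤ (p : ℕ) := by
    exact_mod_cast lt_of_le_of_ne p.2.two_le (Ne.symm hp)
  calc ((p : ℕ) : ℝ) ^ (-(1 + u)) ≤ ((p : ℕ) : ℝ) ^ (-1 : ℝ) :=
        Real.rpow_le_rpow_of_exponent_le (by linarith) (by linarith)
    _ ≤ 1 / 3 := by
        rw [Real.rpow_neg_one, ← one_div]
        exact one_div_le_one_div_of_le (by norm_num) h3

/-- The contribution of the prime `p` to the regular part at `s = 1 + u`. -/
noncomputable def oddTerm (u : ℝ) (p : Nat.Primes) (z : ℂ) : ℂ :=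
  if (p : ℕ) = 2 then 0 else logFactor z (((p : ℕ) : ℝ) ^ (-(1 + u)))

theorem norm_oddTerm_le {u : ℝ} (hu : 0 ≤ u) (p : Nat.Primes) {z : ℂ} (hz : ‖z‖ ≤ 11 / 4) :
    ‖oddTerm u p z‖ ≤ 200 * ((p : ℕ) : ℝ) ^ (-2 : ℝ) := by
  unfold oddTerm
  split_ifs with h
  · rw [norm_zero]; positivity
  have hp1 : (1 : ℝ) ≤ (p : ℕ) := by exact_mod_cast p.2.one_le
  refine (norm_logFactor_le hz (by positivity) (prime_rpow_le_third h hu)).trans ?_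
  rw [← Real.rpow_natCast, ← Real.rpow_mul (by positivity)]
  gcongr
  push_cast; linarith

theorem norm_oddTerm_sub_le {u : ℝ} (hu : 0 ≤ u) (p : Nat.Primes) {z : ℂ} (hz : ‖z‖ ≤ 11 / 4) :
    ‖oddTerm u p z - oddTerm 0 p z‖ ≤ u * (400 * ((p : ℕ) : ℝ) ^ (-(3 / 2) : ℝ)) := by
  unfold oddTerm
  split_ifs with h
  · simpa using by positivity
  have hp1 : (1 : ℝ) ≤ (p : ℕ) := by exact_mod_cast p.2.one_le
  have hp0 : (0 : ℝ) < (p : ℕ) := by linarith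
  have hle : ((p : ℕ) : ℝ) ^ (-(1 + u)) ≤ ((p : ℕ) : ℝ) ^ (-(1 + 0) : ℝ) :=
    Real.rpow_le_rpow_of_exponent_le hp1 (by linarith)
  rw [norm_sub_rev]
  refine (norm_logFactor_sub_le hz (by positivity) hle (prime_rpow_le_third h le_rfl)).trans ?_
  have hd : ((p : ℕ) : ℝ) ^ (-(1 + 0) : ℝ) - ((p : ℕ) : ℝ) ^ (-(1 + u)) ≤
      ((p : ℕ) : ℝ) ^ (-(1 + 0) : ℝ) * (u * (2 * ((p : ℕ) : ℝ) ^ (1 / 2 : ℝ))) := by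
    have e : ((p : ℕ) : ℝ) ^ (-(1 + u)) =
        ((p : ℕ) : ℝ) ^ (-(1 + 0) : ℝ) * Real.exp (-(u * Real.log (p : ℕ))) := by
      rw [show -(1 + u) = -(1 + 0) + -u by ring, Real.rpow_add hp0, Real.rpow_def_of_pos hp0 (-u)]
      ring_nf
    have h1 := Real.add_one_le_exp (-(u * Real.log (p : ℕ)))
    have h2 : Real.log (p : ℕ) ≤ 2 * ((p : ℕ) : ℝ) ^ (1 / 2 : ℝ) := by
      have := Real.log_le_rpow_div hp0.le (show (0 : ℝ) < 1 / 2 by norm_num)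
      linarith
    have h4 := mul_le_mul_of_nonneg_left h2 hu
    rw [e, ← mul_one_sub]
    exact mul_le_mul_of_nonneg_left (by linarith) (by positivity)
  calc _ ≤ 200 * ((p : ℕ) : ℝ) ^ (-(1 + 0) : ℝ) *
        (((p : ℕ) : ℝ) ^ (-(1 + 0) : ℝ) * (u * (2 * ((p : ℕ) : ℝ) ^ (1 / 2 : ℝ)))) := by gcongr
    _ = u * (400 * (((p : ℕ) : ℝ) ^ (-(1 + 0) : ℝ) * ((p : ℕ) : ℝ) ^ (-(1 + 0) : ℝ) *
        ((p : ℕ) : ℝ) ^ (1 / 2 : ℝ))) := by ring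
    _ = _ := by
        rw [← Real.rpow_add hp0, ← Real.rpow_add hp0]
        norm_num

theorem summable_oddTerm {u : ℝ} (hu : 0 ≤ u) {z : ℂ} (hz : ‖z‖ ≤ 11 / 4) :
    Summable fun p => oddTerm u p z :=
  .of_norm_bounded ((Nat.Primes.summable_rpow.2 (by norm_num)).mul_left 200)
    fun p => norm_oddTerm_le hu p hz

theorem exists_norm_tsum_oddTerm_sub_le : ∃ C, 0 ≤ C ∧ ∀ u : ℝ, 0 ≤ u → ∀ z : ℂ, ‖z‖ ≤ 11 / 4 →
    ‖∑' p, oddTerm u p z‖ ≤ C ∧ ‖∑' p, oddTerm u p z - ∑' p, oddTerm 0 p z‖ ≤ C * u := by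
  have s1 : Summable fun p : Nat.Primes => 200 * ((p : ℕ) : ℝ) ^ (-2 : ℝ) :=
    (Nat.Primes.summable_rpow.2 (by norm_num)).mul_left 200
  have s2 : Summable fun p : Nat.Primes => 400 * ((p : ℕ) : ℝ) ^ (-(3 / 2) : ℝ) :=
    (Nat.Primes.summable_rpow.2 (by norm_num)).mul_left 400
  refine ⟨max (∑' p : Nat.Primes, 200 * ((p : ℕ) : ℝ) ^ (-2 : ℝ))
    (∑' p : Nat.Primes, 400 * ((p : ℕ) : ℝ) ^ (-(3 / 2) : ℝ)),
    le_max_of_le_left (tsum_nonneg fun p => by positivity), fun u hu z hz => ⟨?_, ?_⟩⟩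
  · exact (tsum_of_norm_bounded s1.hasSum fun p => norm_oddTerm_le hu p hz).trans (le_max_left _ _)
  · rw [← (summable_oddTerm hu hz).tsum_sub (summable_oddTerm le_rfl hz)]
    refine (tsum_of_norm_bounded (s2.mul_left u).hasSum
      fun p => norm_oddTerm_sub_le hu p hz).trans ?_
    rw [tsum_mul_left, mul_comm]
    exact mul_le_mul_of_nonneg_right (le_max_right _ _) hu

theorem differentiableOn_tsum_oddTerm {u : ℝ} (hu : 0 ≤ u) :
    DifferentiableOn ℂ (fun z => ∑' p, oddTerm u p z) (Metric.ball 0 (11 / 4)) := by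
  refine Complex.differentiableOn_tsum_of_summable_norm
    ((Nat.Primes.summable_rpow.2 (by norm_num)).mul_left 200) (fun p z hz => ?_) Metric.isOpen_ball
    fun p z hz => norm_oddTerm_le hu p (le_of_lt (by simpa using hz))
  refine DifferentiableAt.differentiableWithinAt ?_
  unfold oddTerm
  split_ifs with h
  · exact differentiableAt_const _
  · exact differentiableAt_logFactor (le_of_lt (by simpa using hz)) (by positivity)
      (prime_rpow_le_third h hu)

/-- The function `n ↦ z ^ Ω(n) / n ^ (1 + u)`. -/
noncomputable def weightedPow {u : ℝ} (hu : 0 < u) (z : ℂ) : ℕ →*₀ ℂ where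
  toFun n := z ^ n.primeFactorsList.length * ((n : ℝ) ^ (-(1 + u)) : ℝ)
  map_zero' := by
    rw [Nat.cast_zero, Real.zero_rpow (by linarith)]
    simp
  map_one' := by simp
  map_mul' m n := by
    rcases eq_or_ne m 0 with rfl | hm
    · simp only [zero_mul, Nat.cast_zero, Real.zero_rpow (show -(1 + u) ≠ 0 by linarith)]
      simp
    rcases eq_or_ne n 0 with rfl | hn
    · simp only [mul_zero, Nat.cast_zero, Real.zero_rpow (show -(1 + u) ≠ 0 by linarith)]
      simp
    have := ArithmeticFunction.cardFactors_mul hm hn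
    simp only [ArithmeticFunction.cardFactors_apply] at this
    rw [this, pow_add, Nat.cast_mul, Real.mul_rpow (by positivity) (by positivity)]
    push_cast
    ring

theorem weightedPow_apply {u : ℝ} (hu : 0 < u) (z : ℂ) (n : ℕ) :
    weightedPow hu z n = z ^ n.primeFactorsList.length * ((n : ℝ) ^ (-(1 + u)) : ℝ) := rfl

theorem weightedPow_prime {u : ℝ} (hu : 0 < u) (z : ℂ) (p : Nat.Primes) :
    weightedPow hu z p = z * (((p : ℕ) : ℝ) ^ (-(1 + u)) : ℝ) := by
  rw [weightedPow_apply, Nat.primeFactorsList_prime p.2]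
  simp

theorem summable_rpow_neg_one_sub {u : ℝ} (hu : 0 < u) :
    Summable fun n : ℕ => (n : ℝ) ^ (-(1 + u)) :=
  Real.summable_nat_rpow.2 (by linarith)

theorem summable_norm_weightedPow {u : ℝ} (hu : 0 < u) {z : ℂ} (hz : ‖z‖ ≤ 1) :
    Summable fun n => ‖weightedPow hu z n‖ := by
  refine .of_nonneg_of_le (fun n => norm_nonneg _) (fun n => ?_) (summable_rpow_neg_one_sub hu)
  rw [weightedPow_apply, norm_mul, norm_pow, Complex.norm_real, Real.norm_of_nonneg (by positivity)]
  exact mul_le_of_le_one_left (by positivity) (pow_le_one₀ (norm_nonneg _) hz)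

/-- The function `u ζ(1 + u)`, continued to `u = 0`. -/
noncomputable def scaledZeta (u : ℝ) : ℝ :=
  if u = 0 then 1 else u * ∑' n : ℕ, 1 / ((n : ℝ) + 1) ^ (1 + u)

theorem one_le_scaledZeta {u : ℝ} (hu : 0 ≤ u) : 1 ≤ scaledZeta u := by
  unfold scaledZeta
  split_ifs with h
  · exact le_rfl
  · exact one_le_mul_tsum_rpow (lt_of_le_of_ne hu (Ne.symm h))

theorem scaledZeta_le {u : ℝ} (hu : 0 ≤ u) : scaledZeta u ≤ 1 + u := by
  unfold scaledZeta
  split_ifs with h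
  · linarith
  · exact mul_tsum_rpow_le (lt_of_le_of_ne hu (Ne.symm h))

theorem exp_tsum_neg_log {u : ℝ} (hu : 0 < u) {z : ℂ} (hz : ‖z‖ ≤ 1) :
    Complex.exp (∑' p : Nat.Primes, -Complex.log (1 - z * (((p : ℕ) : ℝ) ^ (-(1 + u)) : ℝ))) =
      ∑' n, weightedPow hu z n := by
  rw [← EulerProduct.exp_tsum_primes_log_eq_tsum (summable_norm_weightedPow hu hz)]
  simp only [weightedPow_prime]

theorem prime_rpow_le_half (p : Nat.Primes) {u : ℝ} (hu : 0 ≤ u) :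
    ((p : ℕ) : ℝ) ^ (-(1 + u)) ≤ 1 / 2 := by
  have h3 : (2 : ℝ) ≤ (p : ℕ) := by exact_mod_cast p.2.two_le
  calc ((p : ℕ) : ℝ) ^ (-(1 + u)) ≤ ((p : ℕ) : ℝ) ^ (-1 : ℝ) :=
        Real.rpow_le_rpow_of_exponent_le (by linarith) (by linarith)
    _ ≤ 1 / 2 := by
        rw [Real.rpow_neg_one, ← one_div]
        exact one_div_le_one_div_of_le (by norm_num) h3

theorem hasSum_neg_log_primes {u : ℝ} (hu : 0 < u) :
    HasSum (fun p : Nat.Primes => -Real.log (1 - ((p : ℕ) : ℝ) ^ (-(1 + u))))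
      (Real.log (scaledZeta u) - Real.log u) := by
  have hw : ∀ p : Nat.Primes, ((p : ℕ) : ℝ) ^ (-(1 + u)) ≤ 1 / 2 := fun p =>
    prime_rpow_le_half p hu.le
  have hs : Summable fun p : Nat.Primes => -Real.log (1 - ((p : ℕ) : ℝ) ^ (-(1 + u))) := by
    refine .of_nonneg_of_le (fun p => ?_) (fun p => ?_)
      ((Nat.Primes.summable_rpow.2 (show -(1 + u) < -1 by linarith)).mul_left 2)
    · have := hw p
      have h0 : 0 < ((p : ℕ) : ℝ) ^ (-(1 + u)) :=
        Real.rpow_pos_of_pos (by exact_mod_cast p.2.pos) _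
      linarith [Real.log_nonpos (show 0 ≤ 1 - ((p : ℕ) : ℝ) ^ (-(1 + u)) by linarith) (by linarith)]
    · have := hw p
      have h0 : 0 < ((p : ℕ) : ℝ) ^ (-(1 + u)) :=
        Real.rpow_pos_of_pos (by exact_mod_cast p.2.pos) _
      set w := ((p : ℕ) : ℝ) ^ (-(1 + u))
      have h1 : 0 < 1 - w := by linarith
      have h2 := Real.one_sub_inv_le_log_of_pos h1
      have h3 : (1 - w)⁻¹ ≤ 1 + 2 * w := by
        rw [inv_le_iff_one_le_mul₀ h1]
        nlinarith
      linarith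
  have he := exp_tsum_neg_log hu (z := 1) (by simp)
  have e1 : ∀ p : Nat.Primes, -Complex.log (1 - 1 * (((p : ℕ) : ℝ) ^ (-(1 + u)) : ℝ)) =
      ((-Real.log (1 - ((p : ℕ) : ℝ) ^ (-(1 + u))) : ℝ) : ℂ) := by
    intro p
    rw [one_mul, Complex.ofReal_neg, Complex.ofReal_log (by linarith [hw p])]
    push_cast; rfl
  have e2 : ∑' n, weightedPow hu 1 n = ((∑' n : ℕ, (n : ℝ) ^ (-(1 + u)) : ℝ) : ℂ) := by
    rw [Complex.ofReal_tsum]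
    exact tsum_congr fun n => by rw [weightedPow_apply, one_pow, one_mul]
  rw [tsum_congr e1, e2, ← Complex.ofReal_tsum, ← Complex.ofReal_exp, Complex.ofReal_inj] at he
  have e3 : ∑' n : ℕ, (n : ℝ) ^ (-(1 + u)) = ∑' n : ℕ, 1 / ((n : ℝ) + 1) ^ (1 + u) := by
    rw [(summable_rpow_neg_one_sub hu).tsum_eq_zero_add, Nat.cast_zero,
      Real.zero_rpow (by linarith), zero_add]
    refine tsum_congr fun n => ?_
    rw [Real.rpow_neg (by positivity), one_div]
    push_cast; rfl
  have hsum := hs.hasSum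
  convert hsum using 1
  rw [scaledZeta, if_neg hu.ne', ← e3, ← he, Real.log_mul hu.ne' (Real.exp_pos _).ne', Real.log_exp]
  ring

/-- The linear coefficient in the exponent of the regular part. -/
noncomputable def linCoeff (u : ℝ) : ℝ :=
  Real.log (scaledZeta u) + Real.log (1 - (2 : ℝ) ^ (-(1 + u)))

/-- The regular part of `∑ z ^ Ω(n) n ^ (-1 - u)`, with the pole at `u = 0` and the Euler factor
at `2` removed. -/
noncomputable def regularPart (u : ℝ) (z : ℂ) : ℂ :=
  Complex.exp (z * linCoeff u + ∑' p, oddTerm u p z)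

theorem linCoeff_zero : linCoeff 0 = Real.log (1 / 2) := by
  simp only [linCoeff, scaledZeta, if_true, Real.log_one, zero_add, add_zero, Real.rpow_neg_one]
  norm_num

theorem abs_linCoeff_sub_le {u : ℝ} (hu : 0 ≤ u) : |linCoeff u - linCoeff 0| ≤ 2 * u := by
  have h1 := one_le_scaledZeta hu
  have h2 := scaledZeta_le hu
  have a1 := Real.log_nonneg h1
  have a2 := Real.log_le_sub_one_of_pos (show 0 < scaledZeta u by linarith)
  have e : (2 : ℝ) ^ (-(1 + u)) = (2 : ℝ) ^ (-u) / 2 := by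
    rw [show -(1 + u) = -u - 1 by ring, Real.rpow_sub two_pos, Real.rpow_one]
  have b1 : (2 : ℝ) ^ (-u) ≤ 1 := Real.rpow_le_one_of_one_le_of_nonpos one_le_two (by linarith)
  have b2 : 1 - u ≤ (2 : ℝ) ^ (-u) := by
    rw [Real.rpow_def_of_pos two_pos]
    have := Real.add_one_le_exp (Real.log 2 * -u)
    have := Real.log_two_lt_d9
    nlinarith
  have e2 : Real.log (1 - (2 : ℝ) ^ (-(1 + u))) - Real.log (1 / 2) =
      Real.log (2 - (2 : ℝ) ^ (-u)) := by
    rw [← Real.log_div (by rw [e]; linarith) (by norm_num), e]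
    congr 1; ring
  have c1 := Real.log_nonneg (show 1 ≤ 2 - (2 : ℝ) ^ (-u) by linarith)
  have c2 := Real.log_le_sub_one_of_pos (show 0 < 2 - (2 : ℝ) ^ (-u) by linarith)
  rw [linCoeff_zero, linCoeff, add_sub_assoc, e2, abs_le]
  constructor <;> linarith

theorem differentiableOn_regularPart {u : ℝ} (hu : 0 ≤ u) :
    DifferentiableOn ℂ (regularPart u) (Metric.ball 0 (11 / 4)) :=
  ((differentiableOn_id.mul_const _).add (differentiableOn_tsum_oddTerm hu)).cexp

theorem exists_norm_regularPart_sub_le : ∃ C, 0 ≤ C ∧ ∀ z : ℂ, ‖z‖ = 5 / 2 →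
    ‖regularPart 0 z‖ ≤ C ∧
      ∀ u : ℝ, 0 ≤ u → u ≤ 1 → ‖regularPart u z - regularPart 0 z‖ ≤ C * u := by
  obtain ⟨C, hC0, hC⟩ := exists_norm_tsum_oddTerm_sub_le
  set B := Real.exp (5 / 2 * |linCoeff 0| + C) with hB
  refine ⟨B + B * ((5 + C) * Real.exp (5 + C)), by positivity, fun z hz => ?_⟩
  have hz' : ‖z‖ ≤ 11 / 4 := by rw [hz]; norm_num
  have h0 : ‖regularPart 0 z‖ ≤ B := by
    refine (Complex.norm_exp_le_exp_norm _).trans (Real.exp_le_exp.2 ?_)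
    refine (norm_add_le _ _).trans (add_le_add (le_of_eq ?_) (hC 0 le_rfl z hz').1)
    rw [norm_mul, hz, Complex.norm_real, Real.norm_eq_abs]
  refine ⟨h0.trans (le_add_of_nonneg_right (by positivity)), fun u hu hu1 => ?_⟩
  set δ : ℂ := z * ((linCoeff u - linCoeff 0 : ℝ) : ℂ) +
    (∑' p, oddTerm u p z - ∑' p, oddTerm 0 p z) with hδ
  have hδn : ‖δ‖ ≤ (5 + C) * u := by
    refine (norm_add_le _ _).trans ?_
    rw [norm_mul, hz, Complex.norm_real, Real.norm_eq_abs]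
    linarith [abs_linCoeff_sub_le hu, (hC u hu z hz').2]
  have e : regularPart u z - regularPart 0 z = regularPart 0 z * (Complex.exp δ - 1) := by
    rw [mul_sub, mul_one, regularPart, regularPart, ← Complex.exp_add, hδ]
    push_cast
    ring_nf
  have h1 : ‖Complex.exp δ - 1‖ ≤ ‖δ‖ * Real.exp ‖δ‖ := by
    simpa using Complex.norm_exp_sub_sum_le_norm_mul_exp δ 1
  have h2 : ‖δ‖ ≤ 5 + C := hδn.trans (mul_le_of_le_one_right (by positivity) hu1)
  rw [e, norm_mul]
  calc _ ≤ B * ((5 + C) * u * Real.exp (5 + C)) := by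
        refine mul_le_mul h0 (h1.trans ?_) (norm_nonneg _) (by positivity)
        gcongr
    _ ≤ _ := by
        have : 0 ≤ B * u := by positivity
        linarith

theorem tsum_weightedPow_eq {u : ℝ} (hu : 0 < u) {z : ℂ} (hz : ‖z‖ < 1) :
    ∑' n, weightedPow hu z n = (1 - z * ((2 : ℝ) ^ (-(1 + u)) : ℝ))⁻¹ *
      Complex.exp (z * (-Real.log u : ℝ)) * regularPart u z := by
  rw [← exp_tsum_neg_log hu hz.le]
  obtain ⟨q, hq⟩ : ∃ q : Nat.Primes, (q : ℕ) = 2 := ⟨⟨2, Nat.prime_two⟩, rfl⟩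
  set w : ℝ := (2 : ℝ) ^ (-(1 + u)) with hw
  have hz2 : ‖z * w‖ < 1 := by
    have : w ≤ 1 / 2 := prime_rpow_le_half ⟨2, Nat.prime_two⟩ hu.le
    rw [norm_mul, Complex.norm_real, Real.norm_of_nonneg (by positivity)]
    nlinarith [norm_nonneg z]
  have hne : 1 - z * w ≠ 0 := by
    intro h
    rw [sub_eq_zero] at h
    rw [← h, norm_one] at hz2
    exact lt_irrefl _ hz2
  have s1 : HasSum (fun p : Nat.Primes => if p = q then
      -Complex.log (1 - z * w) + z * (Real.log (1 - w) : ℝ) else 0)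
      (-Complex.log (1 - z * w) + z * (Real.log (1 - w) : ℝ)) := hasSum_ite_eq _ _
  have s2 := (summable_oddTerm hu.le (z := z) (by linarith)).hasSum
  have s3 := (Complex.hasSum_ofReal.2 (hasSum_neg_log_primes hu)).mul_left z
  have s := (s1.add s2).add s3
  have e : ∀ p : Nat.Primes, (if p = q then
      -Complex.log (1 - z * w) + z * (Real.log (1 - w) : ℝ) else 0) + oddTerm u p z +
      z * ((-Real.log (1 - ((p : ℕ) : ℝ) ^ (-(1 + u))) : ℝ) : ℂ) =
      -Complex.log (1 - z * (((p : ℕ) : ℝ) ^ (-(1 + u)) : ℝ)) := by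
    intro p
    by_cases hp : p = q
    · subst hp
      rw [if_pos rfl, oddTerm, if_pos hq, hq, Nat.cast_ofNat, ← hw]
      push_cast
      ring
    · have hp' : (p : ℕ) ≠ 2 := fun h => hp (Subtype.ext (h.trans hq.symm))
      rw [if_neg hp, oddTerm, if_neg hp', logFactor]
      push_cast
      ring
  simp only [e] at s
  rw [s.tsum_eq, regularPart, linCoeff, ← hw]
  rw [show -Complex.log (1 - z * w) + z * (Real.log (1 - w) : ℝ) + ∑' p, oddTerm u p z +
      z * ((Real.log (scaledZeta u) - Real.log u : ℝ) : ℂ) =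
      -Complex.log (1 - z * w) + (z * (-Real.log u : ℝ) +
        (z * ((Real.log (scaledZeta u) + Real.log (1 - w) : ℝ) : ℂ) + ∑' p, oddTerm u p z)) by
    push_cast; ring]
  rw [Complex.exp_add, Complex.exp_add, Complex.exp_neg, Complex.exp_log hne, mul_assoc]

theorem regularPart_zero_one : regularPart 0 1 = ((1 / 2 : ℝ) : ℂ) := by
  have h : ∀ p, oddTerm 0 p 1 = 0 := by
    intro p
    unfold oddTerm
    split_ifs with hp
    · rfl
    · have := prime_rpow_le_third hp (le_refl (0 : ℝ))
      rw [logFactor]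
      generalize ((p : ℕ) : ℝ) ^ (-(1 + 0) : ℝ) = w at this ⊢
      rw [Complex.ofReal_log (by linarith)]
      push_cast
      ring_nf
  rw [regularPart, tsum_congr h, tsum_zero, add_zero, one_mul, linCoeff_zero, ← Complex.ofReal_exp,
    Real.exp_log (by norm_num)]

theorem oddTerm_zero_two (p : Nat.Primes) : oddTerm 0 p 2 = ((Real.log (if 2 < (p : ℕ) then
    (1 - 2 / ((p : ℕ) : ℝ))⁻¹ * (1 - 1 / ((p : ℕ) : ℝ)) ^ 2 else 1) : ℝ) : ℂ) := by
  by_cases hp : (p : ℕ) = 2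
  · rw [oddTerm, if_pos hp, if_neg (by omega), Real.log_one, Complex.ofReal_zero]
  · have h3 := prime_rpow_le_third hp (le_refl (0 : ℝ))
    rw [add_zero, Real.rpow_neg_one] at h3
    have hp2 : 2 < (p : ℕ) := lt_of_le_of_ne p.2.two_le (Ne.symm hp)
    rw [oddTerm, if_neg hp, if_pos hp2, logFactor, add_zero, Real.rpow_neg_one, div_eq_mul_inv,
      one_div, Real.log_mul (inv_ne_zero (by linarith)) (pow_ne_zero _ (by linarith)), Real.log_inv,
      Real.log_pow]
    have : Complex.log (1 - 2 * (((p : ℕ) : ℝ)⁻¹ : ℝ)) =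
        ((Real.log (1 - 2 * ((p : ℕ) : ℝ)⁻¹) : ℝ) : ℂ) := by
      rw [Complex.ofReal_log (by linarith)]
      push_cast
      rfl
    rw [this]
    push_cast
    rfl

theorem eulerFactor_pos (p : Nat.Primes) : 0 < (if 2 < (p : ℕ) then
    (1 - 2 / ((p : ℕ) : ℝ))⁻¹ * (1 - 1 / ((p : ℕ) : ℝ)) ^ 2 else 1) := by
  split_ifs with h
  · have h2 : (2 : ℝ) < (p : ℕ) := by exact_mod_cast h
    have h3 : 2 / ((p : ℕ) : ℝ) < 1 := by rwa [div_lt_one (by linarith)]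
    have h4 : 1 / ((p : ℕ) : ℝ) < 1 := by rw [div_lt_one (by linarith)]; linarith
    have : 0 < 1 - 2 / ((p : ℕ) : ℝ) := by linarith
    have : 0 < 1 - 1 / ((p : ℕ) : ℝ) := by linarith
    positivity
  · exact one_pos

theorem summable_log_eulerFactor : Summable fun p : Nat.Primes => Real.log (if 2 < (p : ℕ) then
    (1 - 2 / ((p : ℕ) : ℝ))⁻¹ * (1 - 1 / ((p : ℕ) : ℝ)) ^ 2 else 1) := by
  rw [← Complex.summable_ofReal]
  simpa only [oddTerm_zero_two] using summable_oddTerm le_rfl (z := 2) (by norm_num)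

theorem dConst_eq : dConst = 1 / 4 * Real.exp (∑' p : Nat.Primes, Real.log (if 2 < (p : ℕ) then
    (1 - 2 / ((p : ℕ) : ℝ))⁻¹ * (1 - 1 / ((p : ℕ) : ℝ)) ^ 2 else 1)) := by
  rw [dConst, Real.rexp_tsum_eq_tprod eulerFactor_pos summable_log_eulerFactor]

theorem dConst_pos : 0 < dConst := by
  rw [dConst_eq]
  positivity

theorem regularPart_zero_two : regularPart 0 2 = (dConst : ℂ) := by
  rw [regularPart, Complex.exp_add, tsum_congr oddTerm_zero_two, ← Complex.ofReal_tsum,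
    ← Complex.ofReal_exp, linCoeff_zero, dConst_eq, two_mul, Complex.exp_add, ← Complex.ofReal_exp,
    Real.exp_log (by norm_num)]
  push_cast
  ring

/-- The Dirichlet series of the integers with exactly `k` prime factors, at `1 + u`. -/
noncomputable def almostPrimeSeries (k : ℕ) (u : ℝ) : ℝ :=
  ∑' n : ℕ, if n.primeFactorsList.length = k then (n : ℝ) ^ (-(1 + u)) else 0

theorem hasSum_almostPrimeSeries {u : ℝ} (hu : 0 < u) {z : ℂ} (hz : ‖z‖ < 1) :
    HasSum (fun k => (almostPrimeSeries k u : ℂ) * z ^ k) (∑' n, weightedPow hu z n) := by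
  have := (summable_norm_weightedPow hu hz.le).of_norm.hasSum.tsum_fiberwise
    fun n : ℕ => n.primeFactorsList.length
  rw [show (fun k => (almostPrimeSeries k u : ℂ) * z ^ k) = _ from ?_]
  · exact this
  funext k
  rw [tsum_subtype, almostPrimeSeries, Complex.ofReal_tsum, ← tsum_mul_right]
  refine tsum_congr fun n => ?_
  by_cases h : n.primeFactorsList.length = k
  · rw [if_pos h, Set.indicator_of_mem (by simpa using h), weightedPow_apply, h, mul_comm]
  · rw [if_neg h, Set.indicator_of_notMem (by simpa using h), Complex.ofReal_zero, zero_mul]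

/-- The Cauchy product of two sequences. -/
def cauchyConv {R : Type*} [Semiring R] (a b : ℕ → R) (n : ℕ) : R :=
  ∑ ij ∈ Finset.HasAntidiagonal.antidiagonal n, a ij.1 * b ij.2

theorem cauchyConv_mul_pow (a b : ℕ → ℂ) (z : ℂ) (n : ℕ) : cauchyConv a b n * z ^ n =
    ∑ ij ∈ Finset.HasAntidiagonal.antidiagonal n, a ij.1 * z ^ ij.1 * (b ij.2 * z ^ ij.2) := by
  rw [cauchyConv, Finset.sum_mul]
  refine Finset.sum_congr rfl fun ij h => ?_
  rw [← Finset.HasAntidiagonal.mem_antidiagonal.1 h, pow_add]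
  ring

theorem summable_norm_cauchyConv {a b : ℕ → ℂ} {z : ℂ} (ha : Summable fun n => ‖a n * z ^ n‖)
    (hb : Summable fun n => ‖b n * z ^ n‖) : Summable fun n => ‖cauchyConv a b n * z ^ n‖ := by
  simpa only [cauchyConv_mul_pow] using summable_norm_sum_mul_antidiagonal_of_summable_norm ha hb

theorem hasSum_cauchyConv {a b : ℕ → ℂ} {z A B : ℂ} (ha : Summable fun n => ‖a n * z ^ n‖)
    (hb : Summable fun n => ‖b n * z ^ n‖) (hA : HasSum (fun n => a n * z ^ n) A)
    (hB : HasSum (fun n => b n * z ^ n) B) :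
    HasSum (fun n => cauchyConv a b n * z ^ n) (A * B) := by
  have := tsum_mul_tsum_eq_tsum_sum_antidiagonal_of_summable_norm ha hb
  rw [hA.tsum_eq, hB.tsum_eq] at this
  rw [this]
  simp only [← cauchyConv_mul_pow]
  exact (summable_norm_cauchyConv ha hb).of_norm.hasSum

theorem summable_norm_mul_pow {a : ℕ → ℂ} {M r : ℝ} {z : ℂ} (hr0 : 0 ≤ r) (hr : r < 1)
    (ha : ∀ n, ‖a n‖ ≤ M * r ^ n) (hz : ‖z‖ < 1) : Summable fun n => ‖a n * z ^ n‖ := by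
  refine .of_nonneg_of_le (fun n => norm_nonneg _) (fun n => ?_)
    ((summable_geometric_of_lt_one hr0 hr).mul_left M)
  rw [norm_mul, norm_pow]
  exact (mul_le_of_le_one_right (norm_nonneg _) (pow_le_one₀ (norm_nonneg _) hz.le)).trans (ha n)

/-- The coefficients of `u ^ (-z)` as a power series in `z`. -/
noncomputable def logCoeff (u : ℝ) (i : ℕ) : ℝ := (-Real.log u) ^ i / i.factorial

theorem logCoeff_nonneg {u : ℝ} (hu : 0 < u) (hu1 : u ≤ 1) (i : ℕ) : 0 ≤ logCoeff u i := by
  have := Real.log_nonpos hu.le hu1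
  have : 0 ≤ -Real.log u := by linarith
  unfold logCoeff
  positivity

theorem abs_cauchyConv_le_of_forall_le {a b c d : ℕ → ℝ} {n : ℕ} (h1 : ∀ i ≤ n, |a i| ≤ c i)
    (h2 : ∀ i ≤ n, |b i| ≤ d i) : |cauchyConv a b n| ≤ cauchyConv c d n := by
  refine (Finset.abs_sum_le_sum_abs _ _).trans (Finset.sum_le_sum fun ij hij => ?_)
  have hij := Finset.HasAntidiagonal.mem_antidiagonal.1 hij
  rw [abs_mul]
  exact mul_le_mul (h1 _ (by omega)) (h2 _ (by omega)) (abs_nonneg _)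
    ((abs_nonneg _).trans (h1 _ (by omega)))

theorem abs_cauchyConv_le {a b c d : ℕ → ℝ} (h1 : ∀ n, |a n| ≤ c n) (h2 : ∀ n, |b n| ≤ d n)
    (n : ℕ) : |cauchyConv a b n| ≤ cauchyConv c d n :=
  abs_cauchyConv_le_of_forall_le (fun i _ => h1 i) fun i _ => h2 i

theorem exists_almostPrimeSeries_approx : ∃ (η : ℕ → ℝ) (C : ℝ), 0 ≤ C ∧
    (∀ l, |η l| ≤ C * (2 / 5) ^ l) ∧ HasSum η (1 / 2) ∧ HasSum (fun l => η l * 2 ^ l) dConst ∧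
    ∀ u : ℝ, 0 < u → u ≤ 1 → ∀ k,
      |almostPrimeSeries k u -
        cauchyConv (logCoeff u) (cauchyConv η fun j => ((2 : ℝ) ^ (-(1 + u))) ^ j) k| ≤
      C * (u * cauchyConv (logCoeff u)
        (cauchyConv (fun l => (2 / 5) ^ l) fun j => (1 / 2) ^ j) k) := by
  obtain ⟨C, hC0, hC⟩ := exists_norm_regularPart_sub_le
  obtain ⟨h, hh, hhs⟩ := exists_coeff_of_differentiableOn (r := 5 / 2) (by norm_num) (by norm_num)
    (differentiableOn_regularPart le_rfl) fun z hz => (hC z hz).1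
  rw [show (1 : ℝ) / (5 / 2) = 2 / 5 by norm_num] at hh
  refine ⟨fun l => (h l).re, C, hC0, fun l => (Complex.abs_re_le_norm _).trans (hh l), ?_, ?_,
    fun u hu hu1 k => ?_⟩
  · have := Complex.hasSum_re (hhs 1 (by norm_num))
    rw [regularPart_zero_one, Complex.ofReal_re] at this
    simpa using this
  · have := Complex.hasSum_re (hhs 2 (by norm_num))
    rw [regularPart_zero_two, Complex.ofReal_re] at this
    refine this.congr_fun fun l => ?_
    rw [← Complex.ofReal_ofNat, ← Complex.ofReal_pow, Complex.re_mul_ofReal]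
  · obtain ⟨t, ht, hts⟩ := exists_coeff_of_differentiableOn (r := 5 / 2) (by norm_num)
      (by norm_num) ((differentiableOn_regularPart hu.le).sub (differentiableOn_regularPart le_rfl))
      fun z hz => (hC z hz).2 u hu.le hu1
    rw [show (1 : ℝ) / (5 / 2) = 2 / 5 by norm_num] at ht
    set q : ℝ := (2 : ℝ) ^ (-(1 + u)) with hq
    have hq0 : 0 ≤ q := by positivity
    have hq1 : q ≤ 1 / 2 := prime_rpow_le_half ⟨2, Nat.prime_two⟩ hu.le
    have key : (almostPrimeSeries k u : ℂ) = cauchyConv (fun i => (logCoeff u i : ℂ))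
        (cauchyConv (fun l => h l + t l) fun j => (q : ℂ) ^ j) k := by
      refine coeff_eq_of_hasSum (a := fun k => (almostPrimeSeries k u : ℂ))
        (b := cauchyConv (fun i => (logCoeff u i : ℂ))
          (cauchyConv (fun l => h l + t l) fun j => (q : ℂ) ^ j)) (f := fun z => Complex.exp (z * (-Real.log u : ℝ)) *
        (regularPart u z * (1 - z * q)⁻¹)) (fun z hz => ?_) (fun z hz => ?_) k
      · have := hasSum_almostPrimeSeries hu hz
        rw [tsum_weightedPow_eq hu hz, ← hq] at this
        convert this using 1
        ring
      · have hz5 : ‖z‖ < 5 / 2 := by linarith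
        have e1 : ∀ i, (logCoeff u i : ℂ) * z ^ i =
            (z * (-Real.log u : ℝ)) ^ i / (i.factorial : ℂ) := by
          intro i
          rw [logCoeff, mul_pow]
          push_cast
          ring
        have A : Summable fun i => ‖(logCoeff u i : ℂ) * z ^ i‖ := by
          simp only [e1]
          exact NormedSpace.norm_expSeries_div_summable _
        have A' : HasSum (fun i => (logCoeff u i : ℂ) * z ^ i)
            (Complex.exp (z * (-Real.log u : ℝ))) := by
          simp only [e1]
          rw [Complex.exp_eq_exp_ℂ]
          exact NormedSpace.expSeries_div_hasSum_exp _
        have B : Summable fun l => ‖(h l + t l) * z ^ l‖ := by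
          refine summable_norm_mul_pow (M := C + C * u) (r := 2 / 5) (by norm_num) (by norm_num)
            (fun l => (norm_add_le _ _).trans ?_) hz
          linarith [hh l, ht l]
        have B' : HasSum (fun l => (h l + t l) * z ^ l) (regularPart u z) := by
          have := (hhs z hz5).add (hts z hz5)
          simp only [← add_mul, Pi.sub_apply, add_sub_cancel] at this
          exact this
        have D : Summable fun j => ‖(q : ℂ) ^ j * z ^ j‖ := by
          refine summable_norm_mul_pow (M := 1) (r := 1 / 2) (by norm_num) (by norm_num)
            (fun j => ?_) hz
          rw [norm_pow, Complex.norm_real, Real.norm_of_nonneg hq0, one_mul]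
          gcongr
        have D' : HasSum (fun j => (q : ℂ) ^ j * z ^ j) (1 - z * q)⁻¹ := by
          simp only [← mul_pow, mul_comm z]
          refine hasSum_geometric_of_norm_lt_one ?_
          rw [norm_mul, Complex.norm_real, Real.norm_of_nonneg hq0]
          nlinarith [norm_nonneg z]
        exact hasSum_cauchyConv A (summable_norm_cauchyConv B D) A' (hasSum_cauchyConv B D B' D')
    have key' : almostPrimeSeries k u -
        cauchyConv (logCoeff u) (cauchyConv (fun l => (h l).re) fun j => q ^ j) k =
        cauchyConv (logCoeff u) (cauchyConv (fun l => (t l).re) fun j => q ^ j) k := by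
      have := congrArg Complex.re key
      rw [Complex.ofReal_re] at this
      rw [this]
      simp only [cauchyConv, Complex.re_sum, Complex.re_ofReal_mul, ← Complex.ofReal_pow,
        Complex.re_mul_ofReal, Complex.add_re, add_mul, Finset.sum_add_distrib, mul_add]
      ring
    rw [key']
    refine (abs_cauchyConv_le (fun i => (abs_of_nonneg (logCoeff_nonneg hu hu1 i)).le)
      (abs_cauchyConv_le (c := fun l => C * u * (2 / 5) ^ l) (d := fun j => (1 / 2) ^ j)
        (fun l => (Complex.abs_re_le_norm _).trans (ht l)) fun j => ?_) k).trans (le_of_eq ?_)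
    · rw [abs_of_nonneg (by positivity)]
      gcongr
    · simp only [cauchyConv, Finset.mul_sum]
      refine Finset.sum_congr rfl fun _ _ => Finset.sum_congr rfl fun _ _ => ?_
      ring

theorem logCoeff_le {u : ℝ} (hu : 0 < u) (hu1 : u ≤ 1) (i : ℕ) :
    logCoeff u i ≤ 2 ^ i * u ^ (-(1 / 2) : ℝ) := by
  have hL : 0 ≤ -Real.log u := by linarith [Real.log_nonpos hu.le hu1]
  have h := Real.pow_div_factorial_le_exp (-Real.log u / 2) (by linarith) i
  have e : Real.exp (-Real.log u / 2) = u ^ (-(1 / 2) : ℝ) := by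
    rw [Real.rpow_def_of_pos hu]
    ring_nf
  rw [e, div_pow, div_right_comm, div_le_iff₀ (by positivity)] at h
  rw [logCoeff]
  linarith

theorem measurable_logCoeff (i : ℕ) : Measurable fun u => logCoeff u i := by
  unfold logCoeff
  fun_prop

theorem integrableOn_logCoeff (i : ℕ) :
    MeasureTheory.IntegrableOn (fun u => logCoeff u i) (Set.Ioc 0 1) := by
  have h : MeasureTheory.IntegrableOn (fun u : ℝ => 2 ^ i * u ^ (-(1 / 2) : ℝ)) (Set.Ioc 0 1) := by
    rw [← intervalIntegrable_iff_integrableOn_Ioc_of_le zero_le_one]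
    exact (intervalIntegral.intervalIntegrable_rpow' (by norm_num)).const_mul _
  refine h.mono' (measurable_logCoeff i).aestronglyMeasurable ?_
  filter_upwards [MeasureTheory.ae_restrict_mem measurableSet_Ioc] with u hu
  rw [Real.norm_of_nonneg (logCoeff_nonneg hu.1 hu.2 i)]
  exact logCoeff_le hu.1 hu.2 i

theorem integrableOn_pow_mul_logCoeff (a i : ℕ) :
    MeasureTheory.IntegrableOn (fun u => u ^ a * logCoeff u i) (Set.Ioc 0 1) := by
  refine (integrableOn_logCoeff i).mono'
    ((measurable_id.pow_const a).mul (measurable_logCoeff i)).aestronglyMeasurable ?_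
  filter_upwards [MeasureTheory.ae_restrict_mem measurableSet_Ioc] with u hu
  have := logCoeff_nonneg hu.1 hu.2 i
  have := hu.1
  rw [Real.norm_of_nonneg (by positivity)]
  exact mul_le_of_le_one_left ‹_› (pow_le_one₀ hu.1.le hu.2)

theorem hasDerivAt_logCoeff_succ {u : ℝ} (hu : u ≠ 0) (i : ℕ) :
    HasDerivAt (fun u => logCoeff u (i + 1)) (-(logCoeff u i / u)) u := by
  have := (((Real.hasDerivAt_log hu).neg.pow (i + 1)).div_const ((i + 1).factorial : ℝ))
  refine this.congr_deriv ?_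
  rw [logCoeff, Nat.factorial_succ]
  have : (i.factorial : ℝ) ≠ 0 := by positivity
  push_cast
  simp only [Pi.neg_apply]
  field_simp

theorem tendsto_pow_mul_logCoeff (a i : ℕ) : Filter.Tendsto (fun u => u ^ (a + 1) * logCoeff u i)
    (nhdsWithin 0 (Set.Ioi 0)) (nhds 0) := by
  have h : Filter.Tendsto (fun u : ℝ => 2 ^ i * u ^ (1 / 2 : ℝ)) (nhdsWithin 0 (Set.Ioi 0))
      (nhds (2 ^ i * 0 ^ (1 / 2 : ℝ))) :=
    ((Real.continuousAt_rpow_const 0 (1 / 2) (Or.inr (by norm_num))).tendsto.mono_left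
      nhdsWithin_le_nhds).const_mul _
  rw [Real.zero_rpow (by norm_num), mul_zero] at h
  refine tendsto_of_tendsto_of_tendsto_of_le_of_le' tendsto_const_nhds h ?_ ?_ <;>
    filter_upwards [Ioc_mem_nhdsGT (zero_lt_one' ℝ)] with u hu
  · have := logCoeff_nonneg hu.1 hu.2 i
    have := hu.1
    positivity
  · have h1 := logCoeff_nonneg hu.1 hu.2 i
    have h2 : u ^ (a + 1) ≤ u := by
      rw [pow_succ]
      exact mul_le_of_le_one_left hu.1.le (pow_le_one₀ hu.1.le hu.2)
    calc u ^ (a + 1) * logCoeff u i ≤ u * (2 ^ i * u ^ (-(1 / 2) : ℝ)) :=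
          mul_le_mul h2 (logCoeff_le hu.1 hu.2 i) h1 hu.1.le
      _ = 2 ^ i * (u ^ (1 : ℝ) * u ^ (-(1 / 2) : ℝ)) := by rw [Real.rpow_one]; ring
      _ = _ := by rw [← Real.rpow_add hu.1]; norm_num

theorem integral_pow_mul_logCoeff (a i : ℕ) :
    ∫ u in Set.Ioc (0 : ℝ) 1, u ^ a * logCoeff u i = (1 / ((a : ℝ) + 1)) ^ (i + 1) := by
  have ha : (a : ℝ) + 1 ≠ 0 := by positivity
  induction i with
  | zero =>
    rw [← intervalIntegral.integral_of_le zero_le_one]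
    simp [logCoeff]
  | succ i ih =>
    have hd : ∀ u ∈ Set.Ioo (0 : ℝ) 1, HasDerivAt (fun u => u ^ (a + 1) * logCoeff u (i + 1))
        (((a : ℝ) + 1) * (u ^ a * logCoeff u (i + 1)) - u ^ a * logCoeff u i) u := by
      intro u hu
      refine ((hasDerivAt_pow (a + 1) u).mul (hasDerivAt_logCoeff_succ hu.1.ne' i)).congr_deriv ?_
      have := hu.1.ne'
      push_cast
      field_simp
      ring
    have h1 := ((integrableOn_pow_mul_logCoeff a (i + 1)).const_mul ((a : ℝ) + 1))
    have hi := h1.sub (integrableOn_pow_mul_logCoeff a i)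
    have hlim : Filter.Tendsto (fun u => u ^ (a + 1) * logCoeff u (i + 1))
        (nhdsWithin 1 (Set.Iio 1)) (nhds 0) := by
      have : ContinuousAt (fun u => u ^ (a + 1) * logCoeff u (i + 1)) 1 :=
        ((hasDerivAt_pow (a + 1) (1 : ℝ)).mul
          (hasDerivAt_logCoeff_succ one_ne_zero i)).continuousAt
      have := this.tendsto.mono_left (nhdsWithin_le_nhds (s := Set.Iio 1))
      simpa [logCoeff] using this
    have key := intervalIntegral.integral_eq_sub_of_hasDerivAt_of_tendsto zero_lt_one hd
      ((intervalIntegrable_iff_integrableOn_Ioc_of_le zero_le_one).2 hi)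
      (tendsto_pow_mul_logCoeff a (i + 1)) hlim
    rw [intervalIntegral.integral_of_le zero_le_one, MeasureTheory.integral_sub h1
      (integrableOn_pow_mul_logCoeff a i), MeasureTheory.integral_const_mul, ih, sub_zero,
      sub_eq_zero] at key
    rw [pow_succ, ← key]
    field_simp

theorem cauchyConv_left_comm {R : Type*} [CommSemiring R] (a b c : ℕ → R) :
    cauchyConv a (cauchyConv b c) = cauchyConv b (cauchyConv a c) := by
  have h : ∀ x y : ℕ → R, PowerSeries.mk (cauchyConv x y) = PowerSeries.mk x * PowerSeries.mk y := by
    intro x y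
    ext n
    simp [PowerSeries.coeff_mul, cauchyConv]
  have : PowerSeries.mk (cauchyConv a (cauchyConv b c)) =
      PowerSeries.mk (cauchyConv b (cauchyConv a c)) := by
    simp only [h, mul_left_comm]
  funext n
  simpa using congrArg (PowerSeries.coeff n) this

theorem integrableOn_pow_mul_cauchyConv (a : ℕ) (c : ℕ → ℝ) (k : ℕ) :
    MeasureTheory.IntegrableOn (fun u => u ^ a * cauchyConv (logCoeff u) c k) (Set.Ioc 0 1) := by
  simp only [cauchyConv, Finset.mul_sum, ← mul_assoc]
  exact MeasureTheory.integrable_finsetSum _ fun ij _ =>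
    (integrableOn_pow_mul_logCoeff a ij.1).mul_const _

theorem integral_pow_mul_cauchyConv (a : ℕ) (c : ℕ → ℝ) (k : ℕ) :
    ∫ u in Set.Ioc (0 : ℝ) 1, u ^ a * cauchyConv (logCoeff u) c k =
      cauchyConv (fun i => (1 / ((a : ℝ) + 1)) ^ (i + 1)) c k := by
  simp only [cauchyConv, Finset.mul_sum, ← mul_assoc]
  rw [MeasureTheory.integral_finsetSum _ fun ij _ =>
    (integrableOn_pow_mul_logCoeff a ij.1).mul_const _]
  simp only [MeasureTheory.integral_mul_const, integral_pow_mul_logCoeff]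

theorem sum_antidiagonal_two_pow_mul_logCoeff_le {u : ℝ} (hu : 0 < u) (hu1 : u ≤ 1) (k : ℕ) :
    u ^ 2 * cauchyConv (logCoeff u) (fun j => (1 / 2) ^ j) k ≤ (1 / 2) ^ k := by
  have hL : 0 ≤ 2 * -Real.log u := by linarith [Real.log_nonpos hu.le hu1]
  have h1 : cauchyConv (logCoeff u) (fun j => (1 / 2) ^ j) k =
      (1 / 2) ^ k * ∑ i ∈ Finset.range (k + 1), (2 * -Real.log u) ^ i / i.factorial := by
    rw [cauchyConv, Finset.Nat.sum_antidiagonal_eq_sum_range_succ_mk, Finset.mul_sum]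
    refine Finset.sum_congr rfl fun i hi => ?_
    have hik : i ≤ k := Nat.lt_succ_iff.1 (Finset.mem_range.1 hi)
    obtain ⟨m, rfl⟩ := Nat.exists_eq_add_of_le hik
    rw [logCoeff, Nat.add_sub_cancel_left, pow_add, mul_pow]
    have : (1 / 2 : ℝ) ^ i * 2 ^ i = 1 := by rw [← mul_pow]; norm_num
    linear_combination (-((-Real.log u) ^ i / i.factorial * (1 / 2) ^ m)) * this
  have h2 := Real.sum_le_exp_of_nonneg hL (k + 1)
  have h3 : u ^ 2 * Real.exp (2 * -Real.log u) = 1 := by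
    rw [show 2 * -Real.log u = -(Real.log u + Real.log u) by ring, Real.exp_neg, Real.exp_add,
      Real.exp_log hu]
    field_simp
  rw [h1]
  calc _ = (1 / 2) ^ k * (u ^ 2 * ∑ i ∈ Finset.range (k + 1), (2 * -Real.log u) ^ i / i.factorial) :=
        by ring
    _ ≤ (1 / 2) ^ k * (u ^ 2 * Real.exp (2 * -Real.log u)) := by gcongr
    _ = _ := by rw [h3, mul_one]

theorem abs_exp_neg_sub_le {x y : ℝ} (hx : 0 ≤ x) (hxy : x ≤ y) :
    |Real.exp (-x) - (1 - x)| ≤ y ^ 2 / (1 + y) := by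
  have h1 := Real.add_one_le_exp (-x)
  have h2 : Real.exp (-x) ≤ (1 + x)⁻¹ := by
    rw [Real.exp_neg]
    exact inv_anti₀ (by linarith) (by linarith [Real.add_one_le_exp x])
  rw [abs_of_nonneg (by linarith)]
  calc Real.exp (-x) - (1 - x) ≤ (1 + x)⁻¹ - (1 - x) := by linarith
    _ = x ^ 2 / (1 + x) := by field_simp; ring
    _ ≤ y ^ 2 / (1 + y) := by
      rw [div_le_div_iff₀ (by linarith) (by linarith)]
      nlinarith [mul_nonneg hx (hx.trans hxy)]

theorem abs_two_rpow_pow_sub_le {u : ℝ} (hu : 0 ≤ u) {j k : ℕ} (hj : j ≤ k) :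
    |((2 : ℝ) ^ (-(1 + u))) ^ j - ((1 / 2) ^ j - Real.log 2 * u * (j * (1 / 2) ^ j))| ≤
      (u * k) ^ 2 / (1 + u * k) * (1 / 2) ^ j := by
  have hl := Real.log_nonneg one_le_two
  have e : ((2 : ℝ) ^ (-(1 + u))) ^ j = (1 / 2) ^ j * Real.exp (-(u * j * Real.log 2)) := by
    rw [neg_add, Real.rpow_add two_pos, Real.rpow_neg_one, mul_pow, ← Real.rpow_mul_natCast
      zero_le_two, Real.rpow_def_of_pos two_pos, one_div]
    ring_nf
  have hx : u * j * Real.log 2 ≤ u * k := by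
    calc u * j * Real.log 2 ≤ u * k * 1 := by
          gcongr
          linarith [Real.log_two_lt_d9]
      _ = _ := mul_one _
  have h := abs_exp_neg_sub_le (by positivity) hx
  rw [e, show (1 / 2 : ℝ) ^ j * Real.exp (-(u * j * Real.log 2)) -
    ((1 / 2) ^ j - Real.log 2 * u * (j * (1 / 2) ^ j)) =
    (Real.exp (-(u * j * Real.log 2)) - (1 - u * j * Real.log 2)) * (1 / 2) ^ j by ring, abs_mul,
    abs_of_pos (by positivity : (0 : ℝ) < (1 / 2) ^ j)]
  gcongr

theorem cauchyConv_two_fifths_le (m : ℕ) :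
    cauchyConv (fun l => (2 / 5 : ℝ) ^ l) (fun j => (1 / 2) ^ j) m ≤ 5 * (1 / 2) ^ m := by
  have h : cauchyConv (fun l => (2 / 5 : ℝ) ^ l) (fun j => (1 / 2) ^ j) m =
      (1 / 2) ^ m * ∑ i ∈ Finset.range (m + 1), (4 / 5) ^ i := by
    rw [cauchyConv, Finset.Nat.sum_antidiagonal_eq_sum_range_succ_mk, Finset.mul_sum]
    refine Finset.sum_congr rfl fun i hi => ?_
    obtain ⟨n, rfl⟩ := Nat.exists_eq_add_of_le (Nat.lt_succ_iff.1 (Finset.mem_range.1 hi))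
    rw [Nat.add_sub_cancel_left, pow_add, show (2 / 5 : ℝ) = 1 / 2 * (4 / 5) by norm_num, mul_pow]
    ring
  have h2 : ∑ i ∈ Finset.range (m + 1), (4 / 5 : ℝ) ^ i ≤ 5 := by
    rw [geom_sum_eq (by norm_num), div_le_iff_of_neg (by norm_num)]
    have : (0 : ℝ) < (4 / 5) ^ (m + 1) := by positivity
    linarith
  rw [h, mul_comm (5 : ℝ)]
  gcongr

/-- The main term of the approximation to `almostPrimeSeries k u`, affine in `u` up to the
factors `logCoeff u`. -/
noncomputable def mainTerm (η : ℕ → ℝ) (k : ℕ) (u : ℝ) : ℝ :=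
  u ^ 0 * cauchyConv (logCoeff u) (cauchyConv η fun j => (1 / 2) ^ j) k -
    Real.log 2 * (u ^ 1 * cauchyConv (logCoeff u) (cauchyConv η fun j => j * (1 / 2) ^ j) k)

theorem abs_almostPrimeSeries_sub_mainTerm_le {η : ℕ → ℝ} {C u : ℝ} {k : ℕ} (hC : 0 ≤ C)
    (hη : ∀ l, |η l| ≤ C * (2 / 5) ^ l) (hu : 0 < u) (hu1 : u ≤ 1)
    (h : |almostPrimeSeries k u - cauchyConv (logCoeff u)
      (cauchyConv η fun j => ((2 : ℝ) ^ (-(1 + u))) ^ j) k| ≤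
      C * (u * cauchyConv (logCoeff u) (cauchyConv (fun l => (2 / 5) ^ l) fun j => (1 / 2) ^ j) k)) :
    |almostPrimeSeries k u - mainTerm η k u| ≤
      5 * C * (u ^ 1 * cauchyConv (logCoeff u) (fun j => (1 / 2) ^ j) k) +
      5 * C * (1 / 2) ^ k * (k ^ 2 / (1 + u * k)) := by
  have hl := fun i => logCoeff_nonneg hu hu1 i
  have hT : cauchyConv (logCoeff u) (cauchyConv (fun l => (2 / 5) ^ l) fun j => (1 / 2) ^ j) k ≤
      5 * cauchyConv (logCoeff u) (fun j => (1 / 2) ^ j) k := by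
    rw [cauchyConv, cauchyConv, Finset.mul_sum]
    refine Finset.sum_le_sum fun ij _ => ?_
    nlinarith [mul_le_mul_of_nonneg_left (cauchyConv_two_fifths_le ij.2) (hl ij.1)]
  have hd : |cauchyConv (logCoeff u) (cauchyConv η fun j => ((2 : ℝ) ^ (-(1 + u))) ^ j) k -
      mainTerm η k u| ≤ C * ((u * k) ^ 2 / (1 + u * k) * cauchyConv (logCoeff u)
        (cauchyConv (fun l => (2 / 5) ^ l) fun j => (1 / 2) ^ j) k) := by
    have e : cauchyConv (logCoeff u) (cauchyConv η fun j => ((2 : ℝ) ^ (-(1 + u))) ^ j) k -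
        mainTerm η k u = cauchyConv (logCoeff u) (cauchyConv η fun j =>
          ((2 : ℝ) ^ (-(1 + u))) ^ j - ((1 / 2) ^ j - Real.log 2 * u * (j * (1 / 2) ^ j))) k := by
      simp only [mainTerm, cauchyConv, Finset.mul_sum, ← Finset.sum_sub_distrib]
      refine Finset.sum_congr rfl fun _ _ => Finset.sum_congr rfl fun _ _ => ?_
      ring
    rw [e]
    refine (abs_cauchyConv_le_of_forall_le (c := logCoeff u) (fun i _ => (abs_of_nonneg (hl i)).le)
      (fun i hi => abs_cauchyConv_le_of_forall_le (fun l _ => hη l) fun j hj =>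
        abs_two_rpow_pow_sub_le hu.le (hj.trans hi))).trans (le_of_eq ?_)
    simp only [cauchyConv, Finset.mul_sum]
    refine Finset.sum_congr rfl fun _ _ => Finset.sum_congr rfl fun _ _ => ?_
    ring
  have hV := sum_antidiagonal_two_pow_mul_logCoeff_le hu hu1 k
  set V := cauchyConv (logCoeff u) (fun j => (1 / 2) ^ j) k
  set T := cauchyConv (logCoeff u) (cauchyConv (fun l => (2 / 5) ^ l) fun j => (1 / 2) ^ j) k
  have h1 : C * (u * T) ≤ 5 * C * (u ^ 1 * V) := by
    calc C * (u * T) ≤ C * (u * (5 * V)) := by gcongr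
      _ = _ := by ring
  have h2 : C * ((u * k) ^ 2 / (1 + u * k) * T) ≤ 5 * C * (1 / 2) ^ k * (k ^ 2 / (1 + u * k)) := by
    calc C * ((u * k) ^ 2 / (1 + u * k) * T) ≤ C * ((u * k) ^ 2 / (1 + u * k) * (5 * V)) := by gcongr
      _ = 5 * C * (u ^ 2 * V) * (k ^ 2 / (1 + u * k)) := by ring
      _ ≤ _ := by gcongr
  calc _ ≤ _ + _ := abs_sub_le _ _ _
    _ ≤ _ := add_le_add h hd
    _ ≤ _ := add_le_add h1 h2

theorem integrableOn_mainTerm (η : ℕ → ℝ) (k : ℕ) :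
    MeasureTheory.IntegrableOn (mainTerm η k) (Set.Ioc 0 1) :=
  (integrableOn_pow_mul_cauchyConv 0 _ k).sub
    ((integrableOn_pow_mul_cauchyConv 1 _ k).const_mul _)

theorem integral_mainTerm (η : ℕ → ℝ) (k : ℕ) :
    ∫ u in Set.Ioc (0 : ℝ) 1, mainTerm η k u =
      cauchyConv (fun _ => 1) (cauchyConv η fun j => (1 / 2) ^ j) k -
      Real.log 2 * cauchyConv (fun i => (1 / 2) ^ (i + 1))
        (cauchyConv η fun j => j * (1 / 2) ^ j) k := by
  simp only [mainTerm]
  rw [MeasureTheory.integral_sub (integrableOn_pow_mul_cauchyConv 0 _ k)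
    ((integrableOn_pow_mul_cauchyConv 1 _ k).const_mul _), MeasureTheory.integral_const_mul,
    integral_pow_mul_cauchyConv, integral_pow_mul_cauchyConv]
  norm_num

theorem integral_mul_cauchyConv_half_pow (k : ℕ) :
    ∫ u in Set.Ioc (0 : ℝ) 1, u ^ 1 * cauchyConv (logCoeff u) (fun j => (1 / 2) ^ j) k =
      (k + 1) / 2 * (1 / 2) ^ k := by
  rw [integral_pow_mul_cauchyConv, cauchyConv, Finset.sum_congr rfl
    (g := fun _ => 1 / 2 * (1 / 2 : ℝ) ^ k), Finset.sum_const, Finset.Nat.card_antidiagonal]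
  · ring
  · intro ij hij
    rw [← Finset.HasAntidiagonal.mem_antidiagonal.1 hij]
    ring

theorem hasDerivAt_mul_log_one_add {k : ℕ} {u : ℝ} (hu : 0 ≤ u) :
    HasDerivAt (fun u : ℝ => k * Real.log (1 + u * k)) ((k : ℝ) ^ 2 / (1 + u * k)) u := by
  have h : 1 + u * k ≠ 0 := by positivity
  refine (((((hasDerivAt_id u).mul_const (k : ℝ)).const_add 1).log h).const_mul (k : ℝ)).congr_deriv
    ?_
  simp only [id]
  field_simp

theorem intervalIntegrable_sq_div (k : ℕ) :
    IntervalIntegrable (fun u : ℝ => (k : ℝ) ^ 2 / (1 + u * k)) MeasureTheory.volume 0 1 := by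
  refine ContinuousOn.intervalIntegrable ?_
  rw [Set.uIcc_of_le zero_le_one]
  refine continuousOn_const.div (by fun_prop) fun u hu => ?_
  have := hu.1
  positivity

theorem integral_sq_div (k : ℕ) :
    ∫ u in Set.Ioc (0 : ℝ) 1, (k : ℝ) ^ 2 / (1 + u * k) = k * Real.log (k + 1) := by
  rw [← intervalIntegral.integral_of_le zero_le_one,
    intervalIntegral.integral_eq_sub_of_hasDerivAt (fun u hu => hasDerivAt_mul_log_one_add ?_)
      (intervalIntegrable_sq_div k)]
  · simp [add_comm]
  · rw [Set.uIcc_of_le zero_le_one] at hu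
    exact hu.1

theorem hasSum_almostPrimeSeries_apply (k : ℕ) {u : ℝ} (hu : 0 < u) :
    HasSum (fun n : ℕ => if n.primeFactorsList.length = k then (n : ℝ) ^ (-(1 + u)) else 0)
      (almostPrimeSeries k u) := by
  refine (Summable.of_nonneg_of_le (fun n => ?_) (fun n => ?_)
    (summable_rpow_neg_one_sub hu)).hasSum <;> split_ifs
  · positivity
  · rfl
  · rfl
  · positivity

theorem measurable_almostPrime_term (k n : ℕ) : Measurable fun u : ℝ =>
    if n.primeFactorsList.length = k then (n : ℝ) ^ (-(1 + u)) else 0 := by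
  split_ifs <;> fun_prop

theorem aestronglyMeasurable_almostPrimeSeries (k : ℕ) :
    MeasureTheory.AEStronglyMeasurable (almostPrimeSeries k)
      (MeasureTheory.volume.restrict (Set.Ioc 0 1)) := by
  refine aestronglyMeasurable_of_tendsto_ae Filter.atTop
    (f := fun N u => ∑ n ∈ Finset.range N,
      if n.primeFactorsList.length = k then (n : ℝ) ^ (-(1 + u)) else 0)
    (fun N => (Finset.measurable_fun_sum _ fun n _ =>
      measurable_almostPrime_term k n).aestronglyMeasurable) ?_
  filter_upwards [MeasureTheory.ae_restrict_mem measurableSet_Ioc] with u hu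
  exact (hasSum_almostPrimeSeries_apply k hu.1).tendsto_sum_nat

theorem hasSum_integral_almostPrimeSeries {k : ℕ}
    (h : MeasureTheory.IntegrableOn (almostPrimeSeries k) (Set.Ioc 0 1)) :
    HasSum (fun n : ℕ => ∫ u in Set.Ioc (0 : ℝ) 1,
      if n.primeFactorsList.length = k then (n : ℝ) ^ (-(1 + u)) else 0)
      (∫ u in Set.Ioc (0 : ℝ) 1, almostPrimeSeries k u) := by
  refine MeasureTheory.hasSum_integral_of_dominated_convergence
    (fun (n : ℕ) u => if n.primeFactorsList.length = k then (n : ℝ) ^ (-(1 + u)) else 0)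
    (fun n => (measurable_almostPrime_term k n).aestronglyMeasurable) (fun n => ?_) ?_ h ?_
  · refine Filter.Eventually.of_forall fun u => (Real.norm_of_nonneg ?_).le
    split_ifs <;> positivity
  · filter_upwards [MeasureTheory.ae_restrict_mem measurableSet_Ioc] with u hu
    exact (hasSum_almostPrimeSeries_apply k hu.1).summable
  · filter_upwards [MeasureTheory.ae_restrict_mem measurableSet_Ioc] with u hu
    exact hasSum_almostPrimeSeries_apply k hu.1

theorem integral_natCast_rpow {n : ℕ} (hn : 1 < n) :
    ∫ u in Set.Ioc (0 : ℝ) 1, (n : ℝ) ^ (-(1 + u)) =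
      1 / (n * Real.log n) - 1 / (n ^ 2 * Real.log n) := by
  have hn0 : (0 : ℝ) < n := by exact_mod_cast zero_lt_one.trans hn
  have hl : Real.log n ≠ 0 := (Real.log_pos (by exact_mod_cast hn)).ne'
  have hd : ∀ u ∈ Set.uIcc (0 : ℝ) 1, HasDerivAt (fun u : ℝ => -((n : ℝ) ^ (-(1 + u)) / Real.log n))
      ((n : ℝ) ^ (-(1 + u))) u := by
    intro u _
    refine ((((hasDerivAt_id u).const_add 1).neg.const_rpow hn0).div_const
      (Real.log n)).neg.congr_deriv ?_
    simp only [id, Pi.neg_apply]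
    field_simp
  have hc : Continuous fun u : ℝ => (n : ℝ) ^ (-(1 + u)) :=
    continuous_const.rpow (by fun_prop) fun _ => Or.inl hn0.ne'
  rw [← intervalIntegral.integral_of_le zero_le_one,
    intervalIntegral.integral_eq_sub_of_hasDerivAt hd (hc.intervalIntegrable _ _),
    add_zero, Real.rpow_neg_one, Real.rpow_neg hn0.le, one_add_one_eq_two, Real.rpow_two]
  field_simp
  ring

theorem one_lt_of_length_primeFactorsList_eq {n k : ℕ} (hk : k ≠ 0)
    (h : n.primeFactorsList.length = k) : 1 < n := by
  by_contra! hn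
  interval_cases n <;> simp at h <;> exact hk h.symm

theorem two_pow_le_of_length_primeFactorsList_eq {n k : ℕ} (hk : k ≠ 0)
    (h : n.primeFactorsList.length = k) : 2 ^ k ≤ n := by
  have := List.pow_card_le_prod n.primeFactorsList 2
    fun p hp => (Nat.prime_of_mem_primeFactorsList hp).two_le
  rwa [h, Nat.prod_primeFactorsList
    (zero_lt_one.trans (one_lt_of_length_primeFactorsList_eq hk h)).ne'] at this

theorem exists_hasSum_inv_sq_mul_log {k : ℕ} (hk : k ≠ 0) :
    ∃ s : ℝ, 0 ≤ s ∧ s ≤ 2 / Real.log 2 * (1 / 2) ^ k ∧ HasSum (fun n : ℕ =>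
      if n.primeFactorsList.length = k then 1 / ((n : ℝ) ^ 2 * Real.log n) else 0) s := by
  have hl : 0 < Real.log 2 := Real.log_pos one_lt_two
  have h0 : ∀ n : ℕ, 0 ≤
      if n.primeFactorsList.length = k then 1 / ((n : ℝ) ^ 2 * Real.log n) else 0 := by
    intro n
    split_ifs
    · have := Real.log_natCast_nonneg n
      positivity
    · rfl
  have hb : ∀ N, ∑ n ∈ Finset.range N,
      (if n.primeFactorsList.length = k then 1 / ((n : ℝ) ^ 2 * Real.log n) else 0) ≤
      2 / Real.log 2 * (1 / 2) ^ k := by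
    intro N
    calc _ ≤ ∑ n ∈ Finset.range N with n.primeFactorsList.length = k,
          1 / Real.log 2 * ((n : ℝ) ^ 2)⁻¹ := by
          rw [← Finset.sum_filter]
          refine Finset.sum_le_sum fun n hn => ?_
          have hn1 := one_lt_of_length_primeFactorsList_eq hk (Finset.mem_filter.1 hn).2
          have hn0 : (0 : ℝ) < n := by exact_mod_cast zero_lt_one.trans hn1
          rw [mul_comm ((n : ℝ) ^ 2), one_div, mul_inv, one_div]
          gcongr
          exact_mod_cast hn1
      _ ≤ ∑ n ∈ Finset.Ioo (2 ^ k - 1) N, 1 / Real.log 2 * ((n : ℝ) ^ 2)⁻¹ := by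
          refine Finset.sum_le_sum_of_subset_of_nonneg (fun n hn => ?_) fun _ _ _ => by positivity
          have hn' := Finset.mem_filter.1 hn
          have h1 := two_pow_le_of_length_primeFactorsList_eq hk hn'.2
          have h2 := Finset.mem_range.1 hn'.1
          have h3 := Nat.one_le_two_pow (n := k)
          exact Finset.mem_Ioo.2 ⟨by omega, h2⟩
      _ ≤ 1 / Real.log 2 * (2 / (((2 ^ k - 1 : ℕ) : ℝ) + 1)) := by
          rw [← Finset.mul_sum]
          gcongr
          exact sum_Ioo_inv_sq_le _ _
      _ = _ := by
          rw [Nat.cast_sub Nat.one_le_two_pow]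
          push_cast
          rw [sub_add_cancel, one_div_pow]
          ring
  have hs := summable_of_sum_range_le h0 hb
  exact ⟨_, tsum_nonneg h0, Real.tsum_le_of_sum_range_le h0 hb, hs.hasSum⟩

theorem abs_erdosSum_sub_integral_le {k : ℕ} (hk : k ≠ 0)
    (h : MeasureTheory.IntegrableOn (almostPrimeSeries k) (Set.Ioc 0 1)) :
    |erdosSum k - ∫ u in Set.Ioc (0 : ℝ) 1, almostPrimeSeries k u| ≤
      2 / Real.log 2 * (1 / 2) ^ k := by
  obtain ⟨s, hs0, hs1, hs⟩ := exists_hasSum_inv_sq_mul_log hk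
  have h1 := (hasSum_integral_almostPrimeSeries h).add hs
  have h2 : erdosSum k = (∫ u in Set.Ioc (0 : ℝ) 1, almostPrimeSeries k u) + s := by
    rw [erdosSum, ← h1.tsum_eq]
    refine tsum_congr fun n => ?_
    by_cases hn : n.primeFactorsList.length = k
    · have hn1 := one_lt_of_length_primeFactorsList_eq hk hn
      rw [if_pos ⟨hn1, hn⟩]
      simp only [if_pos hn]
      rw [integral_natCast_rpow hn1]
      ring
    · simp [hn]
  rw [h2, add_sub_cancel_left, abs_of_nonneg hs0]
  exact hs1

theorem exists_abs_erdosSum_sub_le : ∃ (η : ℕ → ℝ) (C D : ℝ), 0 ≤ C ∧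
    (∀ l, |η l| ≤ C * (2 / 5) ^ l) ∧ HasSum η (1 / 2) ∧ HasSum (fun l => η l * 2 ^ l) dConst ∧
    ∀ k, k ≠ 0 → |erdosSum k - (cauchyConv (fun _ => 1) (cauchyConv η fun j => (1 / 2) ^ j) k -
      Real.log 2 * cauchyConv (fun i => (1 / 2) ^ (i + 1))
        (cauchyConv η fun j => j * (1 / 2) ^ j) k)| ≤ D * (k * Real.log (k + 1)) * (1 / 2) ^ k := by
  obtain ⟨η, C, hC, hη, h1, h2, h⟩ := exists_almostPrimeSeries_approx
  refine ⟨η, C, 4 / Real.log 2 + 5 * C / Real.log 2 + 5 * C, hC, hη, h1, h2, fun k hk => ?_⟩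
  have hI1 := (integrableOn_pow_mul_cauchyConv 1 (fun j => (1 / 2) ^ j) k).const_mul (5 * C)
  have hI2 := ((intervalIntegrable_iff_integrableOn_Ioc_of_le zero_le_one).1
    (intervalIntegrable_sq_div k)).const_mul (5 * C * (1 / 2) ^ k)
  have hb : ∀ u ∈ Set.Ioc (0 : ℝ) 1, |almostPrimeSeries k u - mainTerm η k u| ≤
      5 * C * (u ^ 1 * cauchyConv (logCoeff u) (fun j => (1 / 2) ^ j) k) +
      5 * C * (1 / 2) ^ k * (k ^ 2 / (1 + u * k)) := fun u hu =>
    abs_almostPrimeSeries_sub_mainTerm_le hC hη hu.1 hu.2 (h u hu.1 hu.2 k)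
  have hd : MeasureTheory.IntegrableOn (fun u => almostPrimeSeries k u - mainTerm η k u)
      (Set.Ioc 0 1) := by
    refine (hI1.add hI2).mono' ((aestronglyMeasurable_almostPrimeSeries k).sub
      (integrableOn_mainTerm η k).aestronglyMeasurable) ?_
    filter_upwards [MeasureTheory.ae_restrict_mem measurableSet_Ioc] with u hu using hb u hu
  have hP : MeasureTheory.IntegrableOn (almostPrimeSeries k) (Set.Ioc 0 1) :=
    (hd.add (integrableOn_mainTerm η k)).congr (Filter.Eventually.of_forall fun u => by simp)
  have hint : |(∫ u in Set.Ioc (0 : ℝ) 1, almostPrimeSeries k u) -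
      ∫ u in Set.Ioc (0 : ℝ) 1, mainTerm η k u| ≤
      5 * C * ((k + 1) / 2 * (1 / 2) ^ k) + 5 * C * (1 / 2) ^ k * (k * Real.log (k + 1)) := by
    rw [← MeasureTheory.integral_sub hP (integrableOn_mainTerm η k),
      ← integral_mul_cauchyConv_half_pow, ← integral_sq_div, ← MeasureTheory.integral_const_mul,
      ← MeasureTheory.integral_const_mul, ← MeasureTheory.integral_add hI1 hI2]
    rw [← Real.norm_eq_abs]
    refine MeasureTheory.norm_integral_le_of_norm_le (hI1.add hI2) ?_
    filter_upwards [MeasureTheory.ae_restrict_mem measurableSet_Ioc] with u hu using hb u hu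
  have hs := abs_erdosSum_sub_integral_le hk hP
  rw [integral_mainTerm] at hint
  refine (abs_sub_le _ _ _).trans ((add_le_add hs hint).trans ?_)
  have hl2 : 0 < Real.log 2 := Real.log_pos one_lt_two
  have hk1 : (1 : ℝ) ≤ k := by exact_mod_cast Nat.one_le_iff_ne_zero.2 hk
  have hlk : Real.log 2 ≤ Real.log (k + 1) := Real.log_le_log two_pos (by linarith)
  have hk2 : (k : ℝ) ≤ k * Real.log (k + 1) / Real.log 2 := by
    rw [le_div_iff₀ hl2]
    gcongr
  have h3 : 2 / Real.log 2 + 5 * C * ((k + 1) / 2) ≤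
      (4 / Real.log 2 + 5 * C / Real.log 2) * (k * Real.log (k + 1)) := by
    have h4 : 1 / 2 ≤ k * Real.log (k + 1) := by nlinarith [Real.log_two_gt_d9]
    have h5 := mul_le_mul_of_nonneg_left h4 (by positivity : 0 ≤ 4 / Real.log 2)
    have h6 : 5 * C * ((k + 1) / 2) ≤ 5 * C * (k * Real.log (k + 1) / Real.log 2) := by
      refine mul_le_mul_of_nonneg_left ?_ (by positivity)
      linarith
    calc _ ≤ 4 / Real.log 2 * (k * Real.log (k + 1)) +
          5 * C * (k * Real.log (k + 1) / Real.log 2) := by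
          refine add_le_add (le_trans (le_of_eq ?_) h5) h6
          ring
      _ = _ := by ring
  calc _ = (2 / Real.log 2 + 5 * C * ((k + 1) / 2) + 5 * C * (k * Real.log (k + 1))) *
        (1 / 2) ^ k := by ring
    _ ≤ ((4 / Real.log 2 + 5 * C / Real.log 2) * (k * Real.log (k + 1)) +
        5 * C * (k * Real.log (k + 1))) * (1 / 2) ^ k := by gcongr
    _ = _ := by ring

theorem cauchyConv_one_half_pow (m : ℕ) :
    cauchyConv (fun _ => (1 : ℝ)) (fun j => (1 / 2) ^ j) m = 2 - (1 / 2) ^ m := by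
  have h := Finset.sum_range_reflect (fun j => (1 / 2 : ℝ) ^ j) (m + 1)
  simp only [add_tsub_cancel_right] at h
  rw [cauchyConv, Finset.Nat.sum_antidiagonal_eq_sum_range_succ_mk]
  simp only [one_mul]
  rw [Nat.succ_eq_add_one, h, geom_sum_eq (by norm_num)]
  ring

theorem cauchyConv_half_pow_mul_half_pow (m : ℕ) :
    cauchyConv (fun i => (1 / 2 : ℝ) ^ (i + 1)) (fun j => j * (1 / 2) ^ j) m =
      1 / 4 * (1 / 2) ^ m * (m * (m + 1)) := by
  have h : cauchyConv (fun i => (1 / 2 : ℝ) ^ (i + 1)) (fun j => j * (1 / 2) ^ j) m =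
      (1 / 2) ^ (m + 1) * ∑ j ∈ Finset.range (m + 1), (j : ℝ) := by
    rw [← Finset.sum_range_reflect, cauchyConv,
      Finset.Nat.sum_antidiagonal_eq_sum_range_succ_mk, Finset.mul_sum]
    refine Finset.sum_congr rfl fun i hi => ?_
    obtain ⟨n, rfl⟩ := Nat.exists_eq_add_of_le (Nat.lt_succ_iff.1 (Finset.mem_range.1 hi))
    rw [Nat.add_sub_cancel_left, show i + n + 1 - 1 - i = n by omega]
    ring
  have h2 : ∀ n : ℕ, ∑ j ∈ Finset.range (n + 1), (j : ℝ) = n * (n + 1) / 2 := by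
    intro n
    induction n with
    | zero => simp
    | succ n ih =>
      rw [Finset.sum_range_succ, ih]
      push_cast
      ring
  rw [h, h2]
  ring

theorem sum_range_succ_mul_pow_le (n : ℕ) :
    ∑ l ∈ Finset.range n, ((l : ℝ) + 1) * (4 / 5) ^ l ≤ 25 := by
  have h : ∑ l ∈ Finset.range n, ((l : ℝ) + 1) * (4 / 5) ^ l = 25 - (5 * n + 25) * (4 / 5) ^ n := by
    induction n with
    | zero => norm_num
    | succ n ih =>
      rw [Finset.sum_range_succ, ih]
      push_cast
      ring
  rw [h, sub_le_self_iff]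
  positivity

theorem mul_four_fifths_pow_le (k : ℕ) : k * (4 / 5 : ℝ) ^ k ≤ 4 := by
  have h := one_add_mul_le_pow (a := (1 / 4 : ℝ)) (by norm_num) k
  have h2 : (1 + 1 / 4 : ℝ) ^ k * (4 / 5) ^ k = 1 := by rw [← mul_pow]; norm_num
  have h3 : (0 : ℝ) < (4 / 5) ^ k := by positivity
  nlinarith [mul_le_mul_of_nonneg_right h h3.le]

theorem abs_cauchyConv_sub_le {η : ℕ → ℝ} {C c d : ℝ} {k : ℕ} (hk : k ≠ 0)
    (hη : ∀ l, |η l| ≤ C * (2 / 5) ^ l) (h1 : HasSum η (1 / 2))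
    (h2 : HasSum (fun l => η l * 2 ^ l) d) (hc0 : 0 ≤ c) (hc : c ≤ 1 / 4) :
    |cauchyConv η (fun m => 2 - (1 / 2) ^ m - c * ((1 / 2) ^ m * (m * (m + 1)))) k -
      (1 - c * (d * k ^ 2) * (1 / 2) ^ k)| ≤ 56 * C * k * (1 / 2) ^ k := by
  have hC : 0 ≤ C := by simpa using (abs_nonneg _).trans (hη 0)
  have hk1 : (1 : ℝ) ≤ k := by exact_mod_cast Nat.one_le_iff_ne_zero.2 hk
  have hη2 : ∀ l, |η l * 2 ^ l| ≤ C * (4 / 5) ^ l := by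
    intro l
    rw [abs_mul, abs_of_pos (by positivity : (0 : ℝ) < 2 ^ l)]
    calc _ ≤ C * (2 / 5) ^ l * 2 ^ l := by gcongr; exact hη l
      _ = _ := by rw [mul_assoc, ← mul_pow]; norm_num
  have hp : (0 : ℝ) < (1 / 2) ^ k := by positivity
  have t1 : |∑ l ∈ Finset.range (k + 1), η l - 1 / 2| ≤ C * (1 / 2) ^ k := by
    refine (norm_sub_le_of_geometric_bound_of_hasSum (by norm_num) hη h1 (k + 1)).trans ?_
    rw [pow_succ, div_eq_mul_inv]
    have : (2 / 5 : ℝ) ^ k ≤ (1 / 2) ^ k :=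
      pow_le_pow_left₀ (by norm_num) (by norm_num) k
    norm_num
    nlinarith [mul_nonneg hC hp.le, mul_le_mul_of_nonneg_left this hC]
  have t2 : |∑ l ∈ Finset.range (k + 1), η l * 2 ^ l - d| * k ≤ 16 * C := by
    have := norm_sub_le_of_geometric_bound_of_hasSum (by norm_num) hη2 h2 (k + 1)
    calc _ ≤ C * (4 / 5) ^ (k + 1) / (1 - 4 / 5) * k := by gcongr; exact this
      _ = 4 * C * (k * (4 / 5) ^ k) := by rw [pow_succ]; ring
      _ ≤ 4 * C * 4 := by gcongr; exact mul_four_fifths_pow_le k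
      _ = _ := by ring
  have t3 : |∑ l ∈ Finset.range (k + 1), η l * 2 ^ l *
      (1 + c * (((k : ℝ) - l) * (k - l + 1) - k ^ 2))| ≤ 50 * C * k := by
    calc _ ≤ ∑ l ∈ Finset.range (k + 1), C * (4 / 5) ^ l * (2 * k * (l + 1)) := by
          refine (Finset.abs_sum_le_sum_abs _ _).trans (Finset.sum_le_sum fun l hl => ?_)
          have hlk : (l : ℝ) ≤ k := by
            exact_mod_cast Nat.lt_succ_iff.1 (Finset.mem_range.1 hl)
          have hl0 : (0 : ℝ) ≤ l := l.cast_nonneg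
          rw [abs_mul]
          refine mul_le_mul (hη2 l) ?_ (abs_nonneg _) (by positivity)
          have hb : |((k : ℝ) - l) * (k - l + 1) - k ^ 2| ≤ (2 * k * l + k : ℝ) := by
            rw [abs_le]
            constructor <;> nlinarith
          calc _ ≤ |(1 : ℝ)| + |c * (((k : ℝ) - l) * (k - l + 1) - k ^ 2)| := abs_add_le _ _
            _ ≤ 1 + 1 / 4 * (2 * k * l + k) := by
              rw [abs_one, abs_mul, abs_of_nonneg hc0]
              gcongr
            _ ≤ _ := by nlinarith
      _ = 2 * C * k * ∑ l ∈ Finset.range (k + 1), ((l : ℝ) + 1) * (4 / 5) ^ l := by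
          rw [Finset.mul_sum]
          exact Finset.sum_congr rfl fun _ _ => by ring
      _ ≤ 2 * C * k * 25 := by gcongr; exact sum_range_succ_mul_pow_le _
      _ = _ := by ring
  have e : cauchyConv η (fun m => 2 - (1 / 2) ^ m - c * ((1 / 2) ^ m * (m * (m + 1)))) k -
      (1 - c * (d * k ^ 2) * (1 / 2) ^ k) =
      2 * (∑ l ∈ Finset.range (k + 1), η l - 1 / 2) -
      c * k ^ 2 * (1 / 2) ^ k * (∑ l ∈ Finset.range (k + 1), η l * 2 ^ l - d) -
      (1 / 2) ^ k * ∑ l ∈ Finset.range (k + 1), η l * 2 ^ l *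
        (1 + c * (((k : ℝ) - l) * (k - l + 1) - k ^ 2)) := by
    have : cauchyConv η (fun m => 2 - (1 / 2) ^ m - c * ((1 / 2) ^ m * (m * (m + 1)))) k =
        2 * ∑ l ∈ Finset.range (k + 1), η l -
        c * k ^ 2 * (1 / 2) ^ k * ∑ l ∈ Finset.range (k + 1), η l * 2 ^ l -
        (1 / 2) ^ k * ∑ l ∈ Finset.range (k + 1), η l * 2 ^ l *
          (1 + c * (((k : ℝ) - l) * (k - l + 1) - k ^ 2)) := by
      rw [cauchyConv, Finset.Nat.sum_antidiagonal_eq_sum_range_succ_mk]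
      simp only [Finset.mul_sum, ← Finset.sum_sub_distrib]
      refine Finset.sum_congr rfl fun l hl => ?_
      obtain ⟨n, rfl⟩ := Nat.exists_eq_add_of_le (Nat.lt_succ_iff.1 (Finset.mem_range.1 hl))
      have h : (1 / 2 : ℝ) ^ l * 2 ^ l = 1 := by rw [← mul_pow]; norm_num
      rw [Nat.add_sub_cancel_left, pow_add]
      push_cast
      linear_combination η l * (1 / 2) ^ n * (1 + c * (n * (n + 1))) * h
    rw [this]
    ring
  rw [e]
  refine (abs_sub _ _).trans ((add_le_add_left (abs_sub _ _) _).trans ?_)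
  rw [abs_mul, abs_mul, abs_of_nonneg (by positivity : 0 ≤ c * k ^ 2 * (1 / 2) ^ k), abs_mul,
    abs_two, abs_of_pos hp]
  have h3 : c * k ^ 2 * (1 / 2) ^ k * |∑ l ∈ Finset.range (k + 1), η l * 2 ^ l - d| ≤
      4 * C * k * (1 / 2) ^ k := by
    calc _ = c * k * (1 / 2) ^ k * (|∑ l ∈ Finset.range (k + 1), η l * 2 ^ l - d| * k) := by ring
      _ ≤ 1 / 4 * k * (1 / 2) ^ k * (16 * C) := by gcongr
      _ = _ := by ring
  have h4 : C * (1 / 2) ^ k ≤ C * (1 / 2) ^ k * k := le_mul_of_one_le_right (by positivity) hk1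
  linarith [mul_le_mul_of_nonneg_left t3 hp.le]

theorem exists_abs_erdosSum_sub_quadratic_le : ∃ C : ℝ, 0 ≤ C ∧ ∀ k : ℕ, 1 ≤ k →
    |erdosSum k - (1 - Real.log 2 / 4 * (dConst * k ^ 2) * (1 / 2) ^ k)| ≤
      C * (k * Real.log (k + 1)) * (1 / 2) ^ k := by
  obtain ⟨η, C, D, hC, hη, h1, h2, h⟩ := exists_abs_erdosSum_sub_le
  refine ⟨max D 0 + 112 * C, by positivity, fun k hk => ?_⟩
  have hk0 : k ≠ 0 := by omega
  have hk1 : (1 : ℝ) ≤ k := by exact_mod_cast hk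
  have hl := Real.log_two_gt_d9
  have hl' := Real.log_two_lt_d9
  have e : cauchyConv (fun _ => 1) (cauchyConv η fun j => (1 / 2) ^ j) k -
      Real.log 2 * cauchyConv (fun i => (1 / 2) ^ (i + 1))
        (cauchyConv η fun j => j * (1 / 2) ^ j) k =
      cauchyConv η
        (fun m => 2 - (1 / 2) ^ m - Real.log 2 / 4 * ((1 / 2) ^ m * (m * (m + 1)))) k := by
    rw [cauchyConv_left_comm, cauchyConv_left_comm _ η, funext cauchyConv_one_half_pow,
      funext cauchyConv_half_pow_mul_half_pow]
    simp only [cauchyConv, Finset.mul_sum, ← Finset.sum_sub_distrib]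
    exact Finset.sum_congr rfl fun _ _ => by ring
  have h3 := h k hk0
  rw [e] at h3
  have h4 := abs_cauchyConv_sub_le hk0 hη h1 h2 (c := Real.log 2 / 4) (by linarith) (by linarith)
  refine (abs_sub_le _ _ _).trans ((add_le_add h3 h4).trans ?_)
  have hlk : 1 / 2 ≤ Real.log (k + 1) := by
    linarith [Real.log_le_log two_pos (by linarith : (2 : ℝ) ≤ k + 1)]
  have h5 : D * (k * Real.log (k + 1)) ≤ max D 0 * (k * Real.log (k + 1)) := by
    gcongr
    exact le_max_left _ _
  have h6 : 56 * C * k ≤ 112 * C * (k * Real.log (k + 1)) := by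
    calc 56 * C * k = 112 * C * (k * (1 / 2)) := by ring
      _ ≤ _ := by gcongr
  calc _ = (D * (k * Real.log (k + 1)) + 56 * C * k) * (1 / 2) ^ k := by ring
    _ ≤ (max D 0 * (k * Real.log (k + 1)) + 112 * C * (k * Real.log (k + 1))) * (1 / 2) ^ k := by
      gcongr
    _ = _ := by ring

theorem eventually_lt_succ_of_abs_sub_le {f : ℕ → ℝ} {a C : ℝ} (ha : 0 < a) (hC : 0 ≤ C)
    (h : ∀ k : ℕ, 1 ≤ k → |f k - (1 - a * k ^ 2 * (1 / 2) ^ k)| ≤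
      C * (k * Real.log (k + 1)) * (1 / 2) ^ k) :
    ∀ᶠ k in Filter.atTop, f k < f (k + 1) := by
  have hε : 0 < a / (128 * (C + 1)) := by positivity
  have ho := (Real.isLittleO_log_id_atTop.bound hε)
  have ht : Filter.Tendsto (fun k : ℕ => (k : ℝ) + 2) Filter.atTop Filter.atTop :=
    Filter.tendsto_atTop_add_const_right _ _ tendsto_natCast_atTop_atTop
  filter_upwards [ht.eventually ho, Filter.eventually_ge_atTop 4] with k hk hk4
  have hk4' : (4 : ℝ) ≤ k := by exact_mod_cast hk4
  have hlog : Real.log (k + 2) ≤ a / (128 * (C + 1)) * (k + 2) := by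
    have := (le_abs_self _).trans hk
    rwa [id, Real.norm_of_nonneg (by positivity)] at this
  have h1 := (abs_le.1 (h k (by omega))).2
  have h2 := (abs_le.1 (h (k + 1) (by omega))).1
  push_cast at h2
  rw [add_assoc, one_add_one_eq_two, pow_succ] at h2
  have hl : Real.log (k + 1) ≤ Real.log (k + 2) :=
    Real.log_le_log (by positivity) (by linarith)
  have hl0 : 0 ≤ Real.log (k + 1) := Real.log_nonneg (by linarith)
  have hp : (0 : ℝ) < (1 / 2) ^ k := by positivity
  have key : C * (k * Real.log (k + 1)) + C * ((k + 1) * Real.log (k + 2)) / 2 <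
      a * (k ^ 2 - (k + 1) ^ 2 / 2) := by
    calc _ ≤ C * (k * Real.log (k + 2)) + C * (2 * k * Real.log (k + 2)) / 2 := by
          gcongr
          · linarith
          · linarith
      _ = 2 * C * k * Real.log (k + 2) := by ring
      _ ≤ 2 * C * k * (a / (128 * (C + 1)) * (k + 2)) := by gcongr
      _ ≤ 2 * C * k * (a / (128 * (C + 1)) * (2 * k)) := by gcongr; linarith
      _ = a * k ^ 2 / 32 * (C / (C + 1)) := by field_simp; ring
      _ ≤ a * k ^ 2 / 32 * 1 := by
          gcongr
          exact div_le_one_of_le₀ (by linarith) (by linarith)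
      _ = a * (k ^ 2 / 32) := by ring
      _ < _ := by
          gcongr
          nlinarith
  have := mul_lt_mul_of_pos_right key hp
  linarith

theorem stmt18 :
    (∃ C : ℝ, ∀ k : ℕ, 1 ≤ k →
      |erdosSum k - (1 - Real.log 2 / 4 * (dConst * k ^ 2) / 2 ^ k)|
        ≤ Real.log 2 / 4 * (C * k * Real.log (k + 1)) / 2 ^ k) ∧
    ∃ K : ℕ, ∀ k : ℕ, K ≤ k → erdosSum k < erdosSum (k + 1) := by
  obtain ⟨C, hC, h⟩ := exists_abs_erdosSum_sub_quadratic_le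
  have hl : 0 < Real.log 2 := Real.log_pos one_lt_two
  refine ⟨⟨4 * C / Real.log 2, fun k hk => ?_⟩, ?_⟩
  · have := h k hk
    rw [one_div_pow, mul_one_div, mul_one_div] at this
    refine this.trans (le_of_eq ?_)
    field_simp
  · have ha : 0 < Real.log 2 / 4 * dConst := mul_pos (by positivity) dConst_pos
    exact Filter.eventually_atTop.1 (eventually_lt_succ_of_abs_sub_le ha hC fun k hk =>
      by simpa only [mul_assoc] using h k hk)
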